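/- arXiv:1901.04037 — 2 statements merged into one kernel-verified Lean document; each statement's English description precedes it below -/
import Mathlib

section
/- Let b ≥ 2 be an integer, let 1/b < α < 1, let φ : ℝ → ℝ be a non-constant 1-periodic Lipschitz continuous function, and let G_{α,b}(x) = Σ_{n=0}^∞ α^n·φ(b^n x). Define F : [0,1)×ℝ → [0,1)×ℝ by F(x,y) = (bx mod 1, (y − φ(x))/α). Then for every (x,y) ∈ [0,1)×ℝ, the orbit {F^n(x,y) : n ≥ 0} is bounded if and only if y = G_{α,b}(x). In particular the graph {(x, G_{α,b}(x)) : x ∈ [0,1)} is invariant under F. -/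
/-- The dynamically defined function `G_{α,b}(x) = Σ_{n=0}^∞ α^n φ(b^n x)`. -/
noncomputable def Gfun (α : ℝ) (b : ℕ) (φ : ℝ → ℝ) (x : ℝ) : ℝ :=
  ∑' n : ℕ, α ^ n * φ ((b : ℝ) ^ n * x)

/-- The expanding skew-product map `F(x,y) = (bx mod 1, (y - φ(x))/α)`. -/
noncomputable def Fexp (α : ℝ) (b : ℕ) (φ : ℝ → ℝ) (p : ℝ × ℝ) : ℝ × ℝ :=
  (Int.fract ((b : ℝ) * p.1), (p.2 - φ p.1) / α)

theorem Gfun_summable {α : ℝ} (hα₀ : 0 ≤ α) (hα₁ : α < 1) (b : ℕ) {φ : ℝ → ℝ} {C : ℝ}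
    (hC : ∀ x, |φ x| ≤ C) (x : ℝ) :
    Summable fun n : ℕ => α ^ n * φ ((b : ℝ) ^ n * x) := by
  refine Summable.of_norm_bounded ((summable_geometric_of_lt_one hα₀ hα₁).mul_right C) fun n => ?_
  rw [Real.norm_eq_abs, abs_mul, abs_of_nonneg (pow_nonneg hα₀ n)]
  exact mul_le_mul_of_nonneg_left (hC _) (pow_nonneg hα₀ n)

theorem abs_Gfun_le {α : ℝ} (hα₀ : 0 ≤ α) (hα₁ : α < 1) (b : ℕ) {φ : ℝ → ℝ} {C : ℝ}
    (hC : ∀ x, |φ x| ≤ C) (x : ℝ) : |Gfun α b φ x| ≤ (1 - α)⁻¹ * C := by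
  rw [← Real.norm_eq_abs, Gfun]
  refine tsum_of_norm_bounded ((hasSum_geometric_of_lt_one hα₀ hα₁).mul_right C) fun n => ?_
  rw [Real.norm_eq_abs, abs_mul, abs_of_nonneg (pow_nonneg hα₀ n)]
  exact mul_le_mul_of_nonneg_left (hC _) (pow_nonneg hα₀ n)

theorem Gfun_eq_add_mul {α : ℝ} (hα₀ : 0 ≤ α) (hα₁ : α < 1) (b : ℕ) {φ : ℝ → ℝ} {C : ℝ}
    (hC : ∀ x, |φ x| ≤ C) (x : ℝ) :
    Gfun α b φ x = φ x + α * Gfun α b φ (b * x) := by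
  unfold Gfun
  rw [(Gfun_summable hα₀ hα₁ b hC x).tsum_eq_zero_add, ← tsum_mul_left]
  congr 1
  · simp
  · refine tsum_congr fun n => ?_
    rw [pow_succ, pow_succ, mul_assoc (_ ^ n) (b : ℝ) x]
    ring

theorem Gfun_fract (α : ℝ) (b : ℕ) {φ : ℝ → ℝ} (hper : Function.Periodic φ 1) (x : ℝ) :
    Gfun α b φ (Int.fract x) = Gfun α b φ x := by
  refine tsum_congr fun n => ?_
  rw [← hper.sub_int_mul_eq ((b : ℤ) ^ n * ⌊x⌋) (x := (b : ℝ) ^ n * x)]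
  congr 2
  rw [Int.fract]
  push_cast
  ring

theorem Fexp_apply_graph {α : ℝ} (hα₀ : 0 < α) (hα₁ : α < 1) (b : ℕ) {φ : ℝ → ℝ} {C : ℝ}
    (hC : ∀ x, |φ x| ≤ C) (hper : Function.Periodic φ 1) (x : ℝ) :
    Fexp α b φ (x, Gfun α b φ x) = (Int.fract (b * x), Gfun α b φ (Int.fract (b * x))) := by
  rw [Gfun_fract α b hper, Fexp, Gfun_eq_add_mul hα₀.le hα₁ b hC x]
  refine Prod.ext rfl ?_
  simp only
  field_simp
  ring

/-- The vertical distance to the graph of `Gfun` is multiplied by `α⁻¹` at each step. -/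
theorem Fexp_iterate_sub_Gfun {α : ℝ} (hα₀ : 0 < α) (hα₁ : α < 1) (b : ℕ) {φ : ℝ → ℝ} {C : ℝ}
    (hC : ∀ x, |φ x| ≤ C) (hper : Function.Periodic φ 1) (p : ℝ × ℝ) (n : ℕ) :
    ((Fexp α b φ)^[n] p).2 - Gfun α b φ ((Fexp α b φ)^[n] p).1 =
      α⁻¹ ^ n * (p.2 - Gfun α b φ p.1) := by
  induction n with
  | zero => simp
  | succ n ih =>
    rw [Function.iterate_succ_apply', pow_succ', mul_assoc, ← ih]
    generalize (Fexp α b φ)^[n] p = q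
    simp only [Fexp]
    rw [Gfun_fract α b hper, Gfun_eq_add_mul hα₀.le hα₁ b hC q.1]
    field_simp
    ring

theorem Fexp_iterate_fst_mem (α : ℝ) (b : ℕ) (φ : ℝ → ℝ) {p : ℝ × ℝ}
    (hp : p.1 ∈ Set.Ico (0 : ℝ) 1) (n : ℕ) :
    ((Fexp α b φ)^[n] p).1 ∈ Set.Ico (0 : ℝ) 1 := by
  cases n with
  | zero => exact hp
  | succ n =>
    rw [Function.iterate_succ_apply']
    exact ⟨Int.fract_nonneg _, Int.fract_lt_one _⟩

/-- For `F(x,y) = (bx mod 1, (y-φ(x))/α)` and `(x,y) ∈ [0,1)×ℝ`, the orbit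
`{Fⁿ(x,y) : n ≥ 0}` is bounded iff `y = G_{α,b}(x)`; in particular the graph of `G_{α,b}`
over `[0,1)` is invariant under `F`. -/
theorem Gfun_graph_repeller (b : ℕ) (hb : 2 ≤ b) (α : ℝ)
    (hα₁ : 1 / (b : ℝ) < α) (hα₂ : α < 1) (φ : ℝ → ℝ)
    (hLip : ∃ K : NNReal, LipschitzWith K φ)
    (hper : ∀ x : ℝ, φ (x + 1) = φ x)
    (hnc : ∃ x y : ℝ, φ x ≠ φ y) :
    (∀ x ∈ Set.Ico (0:ℝ) 1, ∀ y : ℝ,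
        Bornology.IsBounded {q : ℝ × ℝ | ∃ n : ℕ, q = (Fexp α b φ)^[n] (x, y)} ↔
          y = Gfun α b φ x) ∧
      Fexp α b φ '' {p : ℝ × ℝ | ∃ x ∈ Set.Ico (0:ℝ) 1, p = (x, Gfun α b φ x)} =
        {p : ℝ × ℝ | ∃ x ∈ Set.Ico (0:ℝ) 1, p = (x, Gfun α b φ x)} := by
  have hb₀ : (0 : ℝ) < b := by exact_mod_cast (by omega : 0 < b)
  have hα₀ : 0 < α := (by positivity : (0 : ℝ) < 1 / b).trans hα₁
  have hper' : Function.Periodic φ 1 := hper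
  obtain ⟨K, hK⟩ := hLip
  obtain ⟨C, hC'⟩ := (hper'.isBounded_of_continuous one_ne_zero hK.continuous).exists_norm_le
  have hC : ∀ x, |φ x| ≤ C := fun x => hC' _ ⟨x, rfl⟩
  refine ⟨fun x hx y => ⟨fun hbdd => ?_, fun hy => ?_⟩, ?_⟩
  · obtain ⟨M, hM⟩ := hbdd.exists_norm_le
    by_contra hne
    have hpos : 0 < |y - Gfun α b φ x| := abs_pos.mpr (sub_ne_zero.mpr hne)
    obtain ⟨n, hn⟩ := (((tendsto_pow_atTop_atTop_of_one_lt
      ((one_lt_inv₀ hα₀).mpr hα₂)).atTop_mul_const hpos).eventually_gt_atTop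
        (M + (1 - α)⁻¹ * C)).exists
    have hdist := congrArg abs (Fexp_iterate_sub_Gfun hα₀ hα₂ b hC hper' (x, y) n)
    rw [abs_mul, abs_of_pos (pow_pos (inv_pos.mpr hα₀) n)] at hdist
    have hsnd := (norm_snd_le ((Fexp α b φ)^[n] (x, y))).trans (hM _ ⟨n, rfl⟩)
    rw [Real.norm_eq_abs] at hsnd
    have hG := abs_Gfun_le hα₀.le hα₂ b hC ((Fexp α b φ)^[n] (x, y)).1
    have htri := abs_sub ((Fexp α b φ)^[n] (x, y)).2 (Gfun α b φ ((Fexp α b φ)^[n] (x, y)).1)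
    simp only at hdist
    linarith
  · refine (((Metric.isBounded_Ico (0 : ℝ) 1).prod
      (Metric.isBounded_closedBall (x := (0 : ℝ)) (r := (1 - α)⁻¹ * C)))).subset ?_
    rintro q ⟨n, rfl⟩
    refine ⟨Fexp_iterate_fst_mem α b φ hx n, ?_⟩
    have hdist := Fexp_iterate_sub_Gfun hα₀ hα₂ b hC hper' (x, y) n
    rw [hy, sub_self, mul_zero, sub_eq_zero, ← hy] at hdist
    rw [mem_closedBall_zero_iff, Real.norm_eq_abs, hdist]
    exact abs_Gfun_le hα₀.le hα₂ b hC _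
  · ext q
    constructor
    · rintro ⟨_, ⟨x, -, rfl⟩, rfl⟩
      exact ⟨_, ⟨Int.fract_nonneg _, Int.fract_lt_one _⟩, Fexp_apply_graph hα₀ hα₂ b hC hper' x⟩
    · rintro ⟨x, hx, rfl⟩
      refine ⟨_, ⟨x / b, ⟨div_nonneg hx.1 hb₀.le, ?_⟩, rfl⟩, ?_⟩
      · rw [div_lt_one hb₀]
        exact hx.2.trans_le (by exact_mod_cast (by omega : 1 ≤ b))
      · rw [Fexp_apply_graph hα₀ hα₂ b hC hper', mul_div_cancel₀ _ hb₀.ne',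
          Int.fract_eq_self.mpr hx]
end

section
/- For every α ∈ (1/2,1), the Takagi function T_α(x) = Σ_{n=0}^∞ α^n·dist(2^n x, ℤ) satisfies dim_H{(x, T_α(x)) : x ∈ [0,1]} = 2 + log α / log 2, where dim_H denotes Hausdorff dimension of a subset of ℝ². -/
/-- The distance from `x` to the nearest integer. -/
noncomputable def distInt (x : ℝ) : ℝ := |x - round x|

/-- The `α`-Takagi function `T_α(x) = Σ_{n=0}^∞ α^n · dist(2^n x, ℤ)`. -/
noncomputable def takagi (α : ℝ) (x : ℝ) : ℝ := ∑' n : ℕ, α ^ n * distInt (2 ^ n * x)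

open MeasureTheory Set

/-! ### Basic properties of the Takagi function -/

lemma distInt_eq_norm (x : ℝ) : distInt x = ‖(x : UnitAddCircle)‖ :=
  (UnitAddCircle.norm_eq).symm

lemma distInt_nonneg (x : ℝ) : 0 ≤ distInt x := abs_nonneg _

lemma distInt_le_half (x : ℝ) : distInt x ≤ 1 / 2 := abs_sub_round x

lemma continuous_distInt : Continuous distInt := by
  rw [funext distInt_eq_norm]
  exact continuous_norm.comp (AddCircle.continuous_mk' 1)

lemma distInt_add_natCast (x : ℝ) (n : ℕ) : distInt (x + n) = distInt x := by
  simp [distInt]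

lemma abs_distInt_sub_le (x y : ℝ) : |distInt x - distInt y| ≤ |x - y| := by
  rw [distInt_eq_norm, distInt_eq_norm]
  refine (abs_norm_sub_norm_le _ _).trans ?_
  rw [← AddCircle.coe_sub, ← distInt_eq_norm]
  simpa [distInt] using round_le (x - y) 0

lemma distInt_half {u : ℝ} (hu : u ∈ Ico (0 : ℝ) 1) : distInt (u / 2) = u / 2 := by
  have : round (u / 2) = 0 := by
    rw [round_eq, Int.floor_eq_iff]; push_cast; constructor <;> linarith [hu.1, hu.2]
  rw [distInt, this, Int.cast_zero, sub_zero, abs_of_nonneg (by linarith [hu.1])]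

lemma distInt_half_add {u : ℝ} (hu : u ∈ Ico (0 : ℝ) 1) :
    distInt ((u + 1) / 2) = (1 - u) / 2 := by
  have : round ((u + 1) / 2) = 1 := by
    rw [round_eq, Int.floor_eq_iff]; push_cast; constructor <;> linarith [hu.1, hu.2]
  rw [distInt, this, abs_of_nonpos (by push_cast; linarith [hu.2])]; push_cast; ring

section Takagi

variable {α : ℝ}

lemma norm_takagi_term_le (h0 : 0 < α) (n : ℕ) (x : ℝ) :
    ‖α ^ n * distInt (2 ^ n * x)‖ ≤ α ^ n := by
  rw [Real.norm_of_nonneg (mul_nonneg (by positivity) (distInt_nonneg _))]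
  have := distInt_le_half (2 ^ n * x)
  exact mul_le_of_le_one_right (by positivity) (by linarith)

lemma summable_takagi (h0 : 0 < α) (h1 : α < 1) (x : ℝ) :
    Summable fun n : ℕ => α ^ n * distInt (2 ^ n * x) :=
  .of_norm_bounded (summable_geometric_of_lt_one h0.le h1) fun n => norm_takagi_term_le h0 n x

lemma continuous_takagi (h0 : 0 < α) (h1 : α < 1) : Continuous (takagi α) :=
  continuous_tsum (fun n => continuous_const.mul (continuous_distInt.comp (by fun_prop)))
    (summable_geometric_of_lt_one h0.le h1) fun n x => norm_takagi_term_le h0 n x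

lemma takagi_eq (h0 : 0 < α) (h1 : α < 1) (x : ℝ) :
    takagi α x = distInt x + α * takagi α (2 * x) := by
  rw [takagi, (summable_takagi h0 h1 x).tsum_eq_zero_add, takagi, ← tsum_mul_left]
  simp only [pow_zero, one_mul, pow_succ]
  congr 1
  refine tsum_congr fun n => ?_
  rw [mul_assoc (2 ^ n)]; ring

lemma takagi_add_one (x : ℝ) : takagi α (x + 1) = takagi α x := by
  refine tsum_congr fun n => ?_
  rw [mul_add, mul_one]
  exact_mod_cast congrArg (α ^ n * ·) (distInt_add_natCast (2 ^ n * x) (2 ^ n))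

lemma takagi_half (h0 : 0 < α) (h1 : α < 1) {u : ℝ} (hu : u ∈ Ico (0 : ℝ) 1) :
    takagi α (u / 2) = u / 2 + α * takagi α u := by
  rw [takagi_eq h0 h1, distInt_half hu, mul_div_cancel₀ _ two_ne_zero]

lemma takagi_half_add (h0 : 0 < α) (h1 : α < 1) {u : ℝ} (hu : u ∈ Ico (0 : ℝ) 1) :
    takagi α ((u + 1) / 2) = (1 - u) / 2 + α * takagi α u := by
  rw [takagi_eq h0 h1, distInt_half_add hu, mul_div_cancel₀ _ two_ne_zero, takagi_add_one]

/-- The oscillation of `takagi α` at scale `2⁻ᴺ` is of order `αᴺ`. -/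
lemma abs_takagi_sub_le (h0 : 1 / 2 < α) (h1 : α < 1) (N : ℕ) {x y : ℝ}
    (hxy : |x - y| ≤ (1 / 2) ^ N) :
    |takagi α x - takagi α y| ≤ (1 / (2 * α - 1) + 1 / (1 - α)) * α ^ N := by
  have hα : 0 < α := by linarith
  have hs := summable_takagi hα h1
  rw [takagi, takagi, ← (hs x).tsum_sub (hs y), ← ((hs x).sub (hs y)).sum_add_tsum_nat_add N]
  refine (abs_add_le _ _).trans ?_
  rw [add_mul]
  refine add_le_add ?_ ?_
  · calc |∑ n ∈ Finset.range N, (α ^ n * distInt (2 ^ n * x) - α ^ n * distInt (2 ^ n * y))|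
        ≤ ∑ n ∈ Finset.range N, (2 * α) ^ n * (1 / 2) ^ N := by
          refine (Finset.abs_sum_le_sum_abs _ _).trans (Finset.sum_le_sum fun n _ => ?_)
          rw [← mul_sub, abs_mul, abs_of_pos (pow_pos hα n), mul_comm 2 α, mul_pow, mul_assoc]
          refine mul_le_mul_of_nonneg_left ((abs_distInt_sub_le _ _).trans ?_) (by positivity)
          rw [← mul_sub, abs_mul, abs_of_pos (by positivity)]
          gcongr
      _ = ((2 * α) ^ N - 1) / (2 * α - 1) * (1 / 2) ^ N := by
          rw [← Finset.sum_mul, geom_sum_eq (by linarith)]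
      _ ≤ 1 / (2 * α - 1) * α ^ N := by
          have : α ^ N = (2 * α) ^ N * (1 / 2) ^ N := by rw [← mul_pow]; congr 1; ring
          rw [this, ← mul_assoc, one_div_mul_eq_div]
          have : 0 < 2 * α - 1 := by linarith
          gcongr
          linarith
  · have hg := (summable_geometric_of_lt_one hα.le h1).mul_right (α ^ N)
    have hb : ∀ n, ‖α ^ (n + N) * distInt (2 ^ (n + N) * x) -
        α ^ (n + N) * distInt (2 ^ (n + N) * y)‖ ≤ α ^ n * α ^ N := fun n => by
      rw [← mul_sub, norm_mul, ← pow_add, Real.norm_of_nonneg (by positivity), Real.norm_eq_abs]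
      refine mul_le_of_le_one_right (by positivity) ?_
      rw [abs_le]
      constructor <;> linarith [distInt_nonneg (2 ^ (n + N) * x), distInt_le_half (2 ^ (n + N) * x),
        distInt_nonneg (2 ^ (n + N) * y), distInt_le_half (2 ^ (n + N) * y)]
    refine (tsum_of_norm_bounded hg.hasSum hb).trans_eq ?_
    rw [tsum_mul_right, tsum_geometric_of_lt_one hα.le h1, one_div]

end Takagi

/-! ### Self-similarity of correlation integrals -/

/-- Lebesgue measure on `[0,1)`. -/
noncomputable abbrev unitVol : Measure ℝ := volume.restrict (Ico 0 1)

instance : IsProbabilityMeasure unitVol := ⟨by simp [unitVol]⟩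

lemma lintegral_unitVol_halves (f : ℝ → ENNReal) :
    ∫⁻ u, f u ∂unitVol =
      2⁻¹ * ∫⁻ u, f (u / 2) ∂unitVol + 2⁻¹ * ∫⁻ u, f ((u + 1) / 2) ∂unitVol := by
  have key (c : ℝ) : ∫⁻ u in Ico (c / 2) ((c + 1) / 2), f u =
      2⁻¹ * ∫⁻ u, f ((u + c) / 2) ∂unitVol := by
    have himg : (fun u : ℝ => (u + c) / 2) '' Ico 0 1 = Ico (c / 2) ((c + 1) / 2) := by
      ext y
      constructor
      · rintro ⟨u, hu, rfl⟩
        exact ⟨by dsimp only; linarith [hu.1], by dsimp only; linarith [hu.2]⟩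
      · intro hy
        exact ⟨2 * y - c, ⟨by linarith [hy.1], by linarith [hy.2]⟩, by ring⟩
    have hd (x : ℝ) : HasDerivAt (fun u : ℝ => (u + c) / 2) (1 / 2) x :=
      ((hasDerivAt_id x).add_const c).div_const 2
    rw [← himg, lintegral_image_eq_lintegral_abs_deriv_mul measurableSet_Ico
      (fun x _ => (hd x).hasDerivWithinAt)
      (fun x _ y _ h => by simpa using h), lintegral_const_mul' _ _ (by simp)]
    congr 1
    rw [abs_of_pos (by norm_num), one_div, ENNReal.ofReal_inv_of_pos two_pos]; simp
  have h0 := key 0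
  have h1 := key 1
  simp only [zero_div, zero_add, add_zero] at h0
  norm_num at h1
  rw [unitVol, ← Ico_union_Ico_eq_Ico (b := (1 / 2 : ℝ)) (by norm_num) (by norm_num),
    lintegral_union measurableSet_Ico
    (by rw [Set.disjoint_left]; intro x hx hy; linarith [hx.2, hy.1]), h0, h1]
  rw [Ico_union_Ico_eq_Ico (by norm_num) (by norm_num)]

/-- The function `T_α(u) + s u`, a projection of the graph point `(u, T_α(u))`. -/
noncomputable def slantedTakagi (α s u : ℝ) : ℝ := takagi α u + s * u

/-- The measure of pairs of points in a common dyadic interval of level `N` at which the values of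
`slantedTakagi α s` differ by at most `ρ`. -/
noncomputable def pairMass (α : ℝ) (N : ℕ) (s ρ : ℝ) : ENNReal :=
  ∫⁻ u, ∫⁻ v, (if ⌊2 ^ N * u⌋ = ⌊2 ^ N * v⌋ ∧ |slantedTakagi α s u - slantedTakagi α s v| ≤ ρ
    then 1 else 0) ∂unitVol ∂unitVol

lemma ae_unitVol_mem : ∀ᵐ u ∂unitVol, u ∈ Ico (0 : ℝ) 1 := ae_restrict_mem measurableSet_Ico

section

variable {α : ℝ}

lemma slantedTakagi_half (h0 : 0 < α) (h1 : α < 1) (s : ℝ) {u : ℝ} (hu : u ∈ Ico (0 : ℝ) 1) :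
    slantedTakagi α s (u / 2) = α * slantedTakagi α ((2 * α)⁻¹ * (s + 1)) u := by
  rw [slantedTakagi, slantedTakagi, takagi_half h0 h1 hu]
  field_simp
  ring

lemma slantedTakagi_half_add (h0 : 0 < α) (h1 : α < 1) (s : ℝ) {u : ℝ} (hu : u ∈ Ico (0 : ℝ) 1) :
    slantedTakagi α s ((u + 1) / 2) =
      α * slantedTakagi α ((2 * α)⁻¹ * (s - 1)) u + (1 + s) / 2 := by
  rw [slantedTakagi, slantedTakagi, takagi_half_add h0 h1 hu]
  field_simp
  ring

lemma floor_two_pow_mul_half (N : ℕ) (u : ℝ) : ⌊2 ^ (N + 1) * (u / 2)⌋ = ⌊2 ^ N * u⌋ := by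
  congr 1; ring

lemma floor_two_pow_mul_half_add (N : ℕ) (u : ℝ) :
    ⌊2 ^ (N + 1) * ((u + 1) / 2)⌋ = ⌊2 ^ N * u⌋ + 2 ^ N := by
  rw [show (2 : ℝ) ^ (N + 1) * ((u + 1) / 2) = 2 ^ N * u + ((2 ^ N : ℤ) : ℝ) by push_cast; ring,
    Int.floor_add_intCast]

lemma floor_two_pow_mul_mem (N : ℕ) {u : ℝ} (hu : u ∈ Ico (0 : ℝ) 1) :
    ⌊2 ^ N * u⌋ ∈ Ico (0 : ℤ) (2 ^ N) := by
  refine ⟨Int.floor_nonneg.2 (mul_nonneg (by positivity) hu.1), Int.floor_lt.2 ?_⟩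
  push_cast
  exact mul_lt_of_lt_one_right (by positivity) hu.2

lemma pairMass_succ (h0 : 0 < α) (h1 : α < 1) (N : ℕ) (s ρ : ℝ) :
    pairMass α (N + 1) s ρ = 4⁻¹ * (pairMass α N ((2 * α)⁻¹ * (s + 1)) (ρ / α) +
      pairMass α N ((2 * α)⁻¹ * (s - 1)) (ρ / α)) := by
  have h4 : (4⁻¹ : ENNReal) = 2⁻¹ * 2⁻¹ := by
    rw [← ENNReal.mul_inv (by simp) (by simp)]; norm_num
  rw [h4, mul_add, mul_assoc, mul_assoc]
  unfold pairMass
  rw [lintegral_unitVol_halves]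
  refine congrArg₂ _ (congrArg _ ?_) (congrArg _ ?_)
  · rw [← lintegral_const_mul' _ _ (by simp)]
    refine lintegral_congr_ae ?_
    filter_upwards [ae_unitVol_mem] with u hu
    rw [lintegral_unitVol_halves]
    have hz : ∫⁻ v, (if ⌊2 ^ (N + 1) * (u / 2)⌋ = ⌊2 ^ (N + 1) * ((v + 1) / 2)⌋ ∧
        |slantedTakagi α s (u / 2) - slantedTakagi α s ((v + 1) / 2)| ≤ ρ
        then 1 else 0 : ENNReal) ∂unitVol = 0 := by
      rw [lintegral_eq_zero_of_ae_eq_zero]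
      filter_upwards [ae_unitVol_mem] with v hv
      rw [floor_two_pow_mul_half, floor_two_pow_mul_half_add, if_neg]; · rfl
      have := (floor_two_pow_mul_mem N hu).2
      have := (floor_two_pow_mul_mem N hv).1
      omega
    rw [hz, mul_zero, add_zero]
    congr 1
    refine lintegral_congr_ae ?_
    filter_upwards [ae_unitVol_mem] with v hv
    rw [floor_two_pow_mul_half, floor_two_pow_mul_half, slantedTakagi_half h0 h1 s hu,
      slantedTakagi_half h0 h1 s hv, ← mul_sub, abs_mul, abs_of_pos h0]
    simp only [le_div_iff₀' h0]
  · rw [← lintegral_const_mul' _ _ (by simp)]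
    refine lintegral_congr_ae ?_
    filter_upwards [ae_unitVol_mem] with u hu
    rw [lintegral_unitVol_halves]
    have hz : ∫⁻ v, (if ⌊2 ^ (N + 1) * ((u + 1) / 2)⌋ = ⌊2 ^ (N + 1) * (v / 2)⌋ ∧
        |slantedTakagi α s ((u + 1) / 2) - slantedTakagi α s (v / 2)| ≤ ρ
        then 1 else 0 : ENNReal) ∂unitVol = 0 := by
      rw [lintegral_eq_zero_of_ae_eq_zero]
      filter_upwards [ae_unitVol_mem] with v hv
      rw [floor_two_pow_mul_half_add, floor_two_pow_mul_half, if_neg]; · rfl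
      have := (floor_two_pow_mul_mem N hu).1
      have := (floor_two_pow_mul_mem N hv).2
      omega
    rw [hz, mul_zero, zero_add]
    congr 1
    refine lintegral_congr_ae ?_
    filter_upwards [ae_unitVol_mem] with v hv
    rw [floor_two_pow_mul_half_add, floor_two_pow_mul_half_add, slantedTakagi_half_add h0 h1 s hu,
      slantedTakagi_half_add h0 h1 s hv, add_sub_add_right_eq_sub, ← mul_sub, abs_mul,
      abs_of_pos h0]
    simp only [add_left_inj, le_div_iff₀' h0]

/-- The signed sum `∑ ± βⁱ⁺¹` over `i < N`, with sign `+` exactly for `i ∈ S`. -/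
noncomputable def signedSum (β : ℝ) (N : ℕ) (S : Finset ℕ) : ℝ :=
  ∑ i ∈ Finset.range N, (if i ∈ S then 1 else -1) * β ^ (i + 1)

lemma signedSum_succ_of_notMem (β : ℝ) (N : ℕ) {S : Finset ℕ} (hS : S ⊆ Finset.range N) :
    signedSum β (N + 1) S = signedSum β N S - β ^ (N + 1) := by
  have : N ∉ S := fun h => by simpa using hS h
  rw [signedSum, Finset.sum_range_succ, if_neg this, signedSum]; ring

lemma signedSum_succ_insert (β : ℝ) (N : ℕ) (S : Finset ℕ) :
    signedSum β (N + 1) (insert N S) = signedSum β N S + β ^ (N + 1) := by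
  rw [signedSum, Finset.sum_range_succ, if_pos (Finset.mem_insert_self _ _), signedSum, one_mul]
  congr 1
  refine Finset.sum_congr rfl fun i hi => ?_
  have : i ≠ N := by simp at hi; omega
  simp [this]

lemma pairMass_eq_sum (h0 : 0 < α) (h1 : α < 1) (N : ℕ) (s ρ : ℝ) :
    pairMass α N s ρ = (4⁻¹) ^ N * ∑ S ∈ (Finset.range N).powerset,
      pairMass α 0 ((2 * α)⁻¹ ^ N * s + signedSum (2 * α)⁻¹ N S) (ρ / α ^ N) := by
  induction N generalizing s ρ with
  | zero => simp [signedSum]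
  | succ N ih =>
    rw [pairMass_succ h0 h1, ih, ih, ← mul_add, ← mul_assoc, ← pow_succ', Finset.range_add_one,
      Finset.sum_powerset_insert (by simp),
      add_comm (∑ S ∈ _, pairMass α 0 (_ * (_ * (s + 1)) + _) _), div_div, ← pow_succ']
    congr 2
    · refine Finset.sum_congr rfl fun S hS => ?_
      rw [signedSum_succ_of_notMem _ _ (Finset.mem_powerset.1 hS)]
      congr 1; ring
    · refine Finset.sum_congr rfl fun S hS => ?_
      rw [signedSum_succ_insert]
      congr 1; ring

end

/-! ### A Frostman bound for signed sums -/

lemma sum_pow_succ_le {θ : ℝ} (h0 : 0 < θ) (h2 : θ ≤ 1 / 2) (L : ℕ) :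
    ∑ l ∈ Finset.range L, θ ^ (l + 1) ≤ 1 - θ ^ L := by
  induction L with
  | zero => simp
  | succ L ih =>
    rw [Finset.sum_range_succ]
    have : θ ^ (L + 1) ≤ θ ^ L / 2 := by
      rw [pow_succ]; nlinarith [pow_pos h0 L]
    linarith

lemma eq_zero_of_abs_sum_pow_lt {θ : ℝ} (h0 : 0 < θ) (h2 : θ ≤ 1 / 2) (L : ℕ) (c : ℕ → ℤ)
    (hc : ∀ l, |c l| ≤ 1) (h : |∑ l ∈ Finset.range L, (c l : ℝ) * θ ^ (l + 1)| < θ ^ L) :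
    ∀ l < L, c l = 0 := by
  induction L generalizing c with
  | zero => simp
  | succ L ih =>
    have hs : ∑ l ∈ Finset.range (L + 1), (c l : ℝ) * θ ^ (l + 1) =
        θ * (c 0 + ∑ l ∈ Finset.range L, (c (l + 1) : ℝ) * θ ^ (l + 1)) := by
      rw [Finset.sum_range_succ', mul_add, Finset.mul_sum, add_comm]
      congr 1
      · ring
      · exact Finset.sum_congr rfl fun l _ => by ring
    rw [hs, abs_mul, abs_of_pos h0, pow_succ', mul_lt_mul_iff_right₀ h0] at h
    have hb : |∑ l ∈ Finset.range L, (c (l + 1) : ℝ) * θ ^ (l + 1)| ≤ 1 - θ ^ L := by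
      refine ((Finset.abs_sum_le_sum_abs _ _).trans (Finset.sum_le_sum fun l _ => ?_)).trans
        (sum_pow_succ_le h0 h2 L)
      rw [abs_mul, abs_of_pos (pow_pos h0 _)]
      exact mul_le_of_le_one_left (by positivity) (by exact_mod_cast hc _)
    have hc0 : c 0 = 0 := by
      by_contra hne
      have h1 : (1 : ℝ) ≤ |(c 0 : ℝ)| := by exact_mod_cast Int.one_le_abs hne
      have := abs_sub_abs_le_abs_sub (c 0 : ℝ)
        (-∑ l ∈ Finset.range L, (c (l + 1) : ℝ) * θ ^ (l + 1))
      rw [sub_neg_eq_add, abs_neg] at this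
      linarith
    rw [hc0, Int.cast_zero, zero_add] at h
    have := ih (fun l => c (l + 1)) (fun l => hc _) h
    rintro (_ | l) hl
    · exact hc0
    · exact this l (by omega)

lemma abs_signedSum_le {β : ℝ} (h0 : 0 < β) (h1 : β < 1) (N : ℕ) (S : Finset ℕ) :
    |signedSum β N S| ≤ β / (1 - β) := by
  calc |signedSum β N S| ≤ ∑ i ∈ Finset.range N, β * β ^ i := by
        refine (Finset.abs_sum_le_sum_abs _ _).trans (Finset.sum_le_sum fun i _ => ?_)
        rw [abs_mul, abs_of_pos (pow_pos h0 _), pow_succ']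
        split_ifs <;> simp
    _ ≤ β / (1 - β) := by
        rw [← Finset.mul_sum, geom_sum_eq h1.ne, ← neg_div_neg_eq, neg_sub, neg_sub, mul_div_assoc']
        have : 0 < 1 - β := by linarith
        gcongr
        nlinarith [pow_pos h0 N]

/-- If `βᵏ ≤ 1/2`, then at most `2^(N - L)` of the sums `signedSum β N S` lie in a set of diameter
less than `2 β^(k L)`. -/
lemma card_le_of_signedSum_close {β : ℝ} (h0 : 0 < β) {k : ℕ} (hk : 0 < k) (hβk : β ^ k ≤ 1 / 2)
    {N L : ℕ} (hL : k * L ≤ N) (F : Finset (Finset ℕ)) (hF : F ⊆ (Finset.range N).powerset)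
    (hclose : ∀ S ∈ F, ∀ S' ∈ F, |signedSum β N S - signedSum β N S'| < 2 * β ^ (k * L)) :
    F.card ≤ 2 ^ (N - L) := by
  classical
  have hinj : Function.Injective fun l => k * (l + 1) - 1 := fun a b hab => by
    have h1 : 0 < k * (a + 1) := by positivity
    have h2 : 0 < k * (b + 1) := by positivity
    have : k * (a + 1) = k * (b + 1) := by dsimp only at hab; omega
    have := Nat.eq_of_mul_eq_mul_left hk this
    omega
  have hpos (l : ℕ) : 0 < k * (l + 1) := by positivity
  set M := (Finset.range L).image fun l => k * (l + 1) - 1 with hM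
  have hMN : M ⊆ Finset.range N := by
    intro i hi
    obtain ⟨l, hl, rfl⟩ := Finset.mem_image.1 hi
    have : k * (l + 1) ≤ k * L := Nat.mul_le_mul_left _ (by simpa using hl)
    have := hpos l
    simp only [Finset.mem_range]; omega
  have hMcard : M.card = L := by rw [hM, Finset.card_image_of_injective _ hinj, Finset.card_range]
  have hcard : (Finset.range N \ M).powerset.card = 2 ^ (N - L) := by
    rw [Finset.card_powerset, Finset.card_sdiff_of_subset hMN, hMcard, Finset.card_range]
  rw [← hcard]
  refine Finset.card_le_card_of_injOn (fun S => S \ M) (fun S hS => ?_) ?_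
  · simp only [Finset.coe_powerset, mem_preimage, mem_powerset_iff, Finset.coe_subset]
    exact Finset.sdiff_subset_sdiff (Finset.mem_powerset.1 (hF hS)) le_rfl
  · intro S hS S' hS' hSS
    have hout : ∀ i ∉ M, (i ∈ S ↔ i ∈ S') := fun i hi => by
      have := Finset.ext_iff.1 hSS i
      simpa [hi] using this
    set c : ℕ → ℤ := fun l =>
      (if k * (l + 1) - 1 ∈ S then 1 else 0) - (if k * (l + 1) - 1 ∈ S' then 1 else 0) with hc
    have hdiff : signedSum β N S - signedSum β N S' =
        2 * ∑ l ∈ Finset.range L, (c l : ℝ) * (β ^ k) ^ (l + 1) := by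
      rw [signedSum, signedSum, ← Finset.sum_sub_distrib, ← Finset.sum_subset hMN, hM,
        Finset.sum_image fun a _ b _ h => hinj h, Finset.mul_sum]
      · refine Finset.sum_congr rfl fun l _ => ?_
        rw [Nat.sub_add_cancel (hpos l), pow_mul, hc]
        dsimp only
        split_ifs <;> push_cast <;> ring
      · intro i _ hi
        simp [hout i hi]
    have hz := eq_zero_of_abs_sum_pow_lt (pow_pos h0 k) hβk L c (fun l => by
      rw [hc]; dsimp only; split_ifs <;> simp) (by
      have := hclose S hS S' hS'
      rw [hdiff, abs_mul, abs_of_pos two_pos, pow_mul] at this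
      linarith)
    ext i
    by_cases hi : i ∈ M
    · obtain ⟨l, hl, rfl⟩ := Finset.mem_image.1 hi
      have := hz l (by simpa using hl)
      rw [hc] at this
      dsimp only at this ⊢
      split_ifs at this with h1 h2 h2
      · exact iff_of_true h1 h2
      · norm_num at this
      · norm_num at this
      · exact iff_of_false h1 h2
    · exact hout i hi

/-! ### Fejér kernels and correlation integrals -/

/-- The Fourier transform of the triangle function `1 - |t|` on `[-1,1]`. -/
noncomputable def fejer (x : ℝ) : ℝ := ∫ t in (-1)..1, (1 - |t|) * Real.cos (x * t)

lemma fejer_eq_two_mul (x : ℝ) : fejer x = 2 * ∫ t in 0..1, (1 - t) * Real.cos (x * t) := by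
  have hc : Continuous fun t : ℝ => (1 - |t|) * Real.cos (x * t) := by fun_prop
  have h1 : ∫ t in 0..1, (1 - |t|) * Real.cos (x * t) =
      ∫ t in 0..1, (1 - t) * Real.cos (x * t) := by
    refine intervalIntegral.integral_congr fun t ht => ?_
    rw [uIcc_of_le zero_le_one] at ht
    simp only [abs_of_nonneg ht.1]
  have h2 : ∫ t in (-1)..0, (1 - |t|) * Real.cos (x * t) =
      ∫ t in 0..1, (1 - |t|) * Real.cos (x * t) := by
    have := intervalIntegral.integral_comp_neg (a := 0) (b := 1)
      fun t : ℝ => (1 - |t|) * Real.cos (x * t)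
    simpa using this.symm
  rw [fejer, ← intervalIntegral.integral_add_adjacent_intervals (b := 0)
    (hc.intervalIntegrable _ _) (hc.intervalIntegrable _ _), h2, h1, two_mul]

lemma fejer_eq {x : ℝ} (hx : x ≠ 0) : fejer x = 2 * (1 - Real.cos x) / x ^ 2 := by
  have hd : ∀ t ∈ uIcc (0 : ℝ) 1, HasDerivAt
      (fun t : ℝ => (1 - t) * (Real.sin (x * t) / x) - Real.cos (x * t) / x ^ 2)
      ((1 - t) * Real.cos (x * t)) t := fun t _ => by
    have hl : HasDerivAt (fun t : ℝ => x * t) x t := by simpa using (hasDerivAt_id t).const_mul x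
    have hm : HasDerivAt (fun t : ℝ => 1 - t) (-1) t := by
      simpa using (hasDerivAt_id t).const_sub 1
    refine ((hm.mul (hl.sin.div_const x)).sub (hl.cos.div_const (x ^ 2))).congr_deriv ?_
    field_simp
    ring
  have hc : Continuous fun t : ℝ => (1 - t) * Real.cos (x * t) := by fun_prop
  rw [fejer_eq_two_mul, intervalIntegral.integral_eq_sub_of_hasDerivAt hd
    (hc.intervalIntegrable _ _)]
  simp
  field_simp
  ring

lemma fejer_zero : fejer 0 = 1 := by
  rw [fejer_eq_two_mul]
  simp only [zero_mul, Real.cos_zero, mul_one]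
  rw [intervalIntegral.integral_sub (by simp) (by simp)]
  norm_num

lemma fejer_nonneg (x : ℝ) : 0 ≤ fejer x := by
  rcases eq_or_ne x 0 with rfl | hx
  · rw [fejer_zero]; exact zero_le_one
  · rw [fejer_eq hx]
    have := Real.cos_le_one x
    exact div_nonneg (by linarith) (sq_nonneg x)

lemma fejer_le (x : ℝ) : fejer x ≤ 5 / (1 + x ^ 2) := by
  rcases eq_or_ne x 0 with rfl | hx
  · rw [fejer_zero]; norm_num
  · have hx2 : 0 < x ^ 2 := by positivity
    have h1 := Real.neg_one_le_cos x
    have h2 := Real.one_sub_sq_div_two_le_cos (x := x)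
    rw [fejer_eq hx, div_le_div_iff₀ hx2 (by positivity)]
    nlinarith

lemma half_le_fejer {x : ℝ} (hx : |x| ≤ 1) : 1 / 2 ≤ fejer x := by
  rcases eq_or_ne x 0 with rfl | h
  · rw [fejer_zero]; norm_num
  · have hx2 : 0 < x ^ 2 := by positivity
    have h3 := Real.cos_bound hx
    rw [fejer_eq h, le_div_iff₀ hx2]
    have h4 := (abs_le.1 h3).2
    have h5 : |x| ^ 4 = x ^ 2 * x ^ 2 := by
      rw [show |x| ^ 4 = (|x| ^ 2) * |x| ^ 2 by ring, sq_abs]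
    have h6 : x ^ 2 ≤ 1 := by rw [← sq_abs]; exact pow_le_one₀ (abs_nonneg _) hx
    rw [h5] at h4
    nlinarith

lemma integral_triangle_mul_sin (x : ℝ) : ∫ t in (-1)..1, (1 - |t|) * Real.sin (x * t) = 0 := by
  have := intervalIntegral.integral_comp_neg (a := -1) (b := 1)
    fun t : ℝ => (1 - |t|) * Real.sin (x * t)
  simp only [abs_neg, mul_neg, Real.sin_neg, neg_neg, intervalIntegral.integral_neg] at this
  linarith

section General

variable {Ω Θ : Type*} [MeasurableSpace Ω] [MeasurableSpace Θ]

lemma norm_integral_exp_sq (P : Measure Ω) [IsFiniteMeasure P] (b X : Ω → ℝ) :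
    ‖∫ u, (b u : ℂ) * Complex.exp (X u * Complex.I) ∂P‖ ^ 2 =
      (∫ z, (b z.1 : ℂ) * b z.2 * Complex.exp ((X z.1 - X z.2 : ℝ) * Complex.I) ∂P.prod P).re := by
  set f : Ω → ℂ := fun u => (b u : ℂ) * Complex.exp (X u * Complex.I) with hf
  have h1 : ((‖∫ u, f u ∂P‖ ^ 2 : ℝ) : ℂ) = ∫ z, f z.1 * (starRingEnd ℂ) (f z.2) ∂P.prod P := by
    rw [integral_prod_mul f (fun u => (starRingEnd ℂ) (f u)), integral_conj, Complex.mul_conj,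
      Complex.normSq_eq_norm_sq]
  rw [← Complex.ofReal_re (‖∫ u, f u ∂P‖ ^ 2), h1]
  congr 2
  ext z
  simp only [hf, map_mul, Complex.conj_ofReal, ← Complex.exp_conj, Complex.conj_I]
  rw [mul_mul_mul_comm, ← Complex.exp_add]
  push_cast
  ring_nf

lemma integrable_amplitude_mul_exp (P : Measure Ω) [IsFiniteMeasure P] {b X : Ω → ℝ} {C : ℝ}
    (hb : Measurable b) (hbC : ∀ u, |b u| ≤ C) (hX : Measurable X) :
    Integrable (fun u => (b u : ℂ) * Complex.exp (X u * Complex.I)) P := by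
  refine Integrable.of_bound (by fun_prop) C (.of_forall fun u => ?_)
  rw [norm_mul, Complex.norm_exp_ofReal_mul_I, mul_one, Complex.norm_real]
  exact hbC u

/-- Squared moduli of exponential sums, expanded as correlations. -/
lemma norm_integral_exp_sq_eq_integral_cos (P : Measure Ω) [IsFiniteMeasure P] {b X : Ω → ℝ} {C : ℝ}
    (hb : Measurable b) (hbC : ∀ u, |b u| ≤ C) (hX : Measurable X) :
    ‖∫ u, (b u : ℂ) * Complex.exp (X u * Complex.I) ∂P‖ ^ 2 =
      ∫ z, b z.1 * b z.2 * Real.cos (X z.1 - X z.2) ∂P.prod P := by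
  have hcorr := integrable_amplitude_mul_exp (P.prod P) (b := fun z : Ω × Ω => b z.1 * b z.2)
    (X := fun z => X z.1 - X z.2) (C := C * C) (by fun_prop)
    (fun z => by
      rw [abs_mul]
      exact mul_le_mul (hbC _) (hbC _) (abs_nonneg _)
        ((abs_nonneg _).trans (hbC z.1))) (by fun_prop)
  rw [norm_integral_exp_sq]
  simp only [Complex.ofReal_mul] at hcorr
  refine (integral_re hcorr).symm.trans (integral_congr_ae (.of_forall fun z => ?_))
  dsimp only
  rw [← Complex.ofReal_mul, RCLike.re_to_complex, Complex.re_ofReal_mul,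
    Complex.exp_ofReal_mul_I_re]

/-- Averages over the phase of squared moduli of exponential sums. -/
lemma integral_weight_mul_norm_integral_exp_sq (P : Measure Ω) [IsFiniteMeasure P]
    (Q : Measure Θ) [IsFiniteMeasure Q] {w : Θ → ℝ} {b : Ω → ℝ} {p : Θ → Ω → ℝ} {C : ℝ}
    (hw : Measurable w) (hw1 : ∀ t, |w t| ≤ 1) (hb : Measurable b) (hbC : ∀ u, |b u| ≤ C)
    (hp : Measurable (Function.uncurry p)) :
    ∫ t, w t * ‖∫ u, (b u : ℂ) * Complex.exp (p t u * Complex.I) ∂P‖ ^ 2 ∂Q =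
      ∫ z, b z.1 * b z.2 * ∫ t, w t * Real.cos (p t z.1 - p t z.2) ∂Q ∂P.prod P := by
  simp only [fun t => norm_integral_exp_sq_eq_integral_cos P hb hbC (hp.of_uncurry_left (x := t)),
    ← integral_const_mul]
  rw [integral_integral_swap]
  · refine integral_congr_ae (.of_forall fun z => integral_congr_ae (.of_forall fun t => ?_))
    dsimp only; ring
  · have h1 : Measurable fun x : Θ × Ω × Ω => p x.1 x.2.1 :=
      hp.comp (measurable_fst.prodMk measurable_snd.fst)
    have h2 : Measurable fun x : Θ × Ω × Ω => p x.1 x.2.2 :=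
      hp.comp (measurable_fst.prodMk measurable_snd.snd)
    refine Integrable.of_bound (C := C * C) ?_ (.of_forall fun x => ?_)
    · refine Measurable.aestronglyMeasurable ?_
      simp only [Function.uncurry_def]
      fun_prop
    · have hC : 0 ≤ C := (abs_nonneg _).trans (hbC x.2.1)
      simp only [Function.uncurry_def, Real.norm_eq_abs, abs_mul]
      calc |w x.1| * (|b x.2.1| * |b x.2.2| * |Real.cos (p x.1 x.2.1 - p x.1 x.2.2)|)
          ≤ 1 * (C * C * 1) := by
            gcongr
            · exact hw1 _
            · exact hbC _
            · exact hbC _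
            · exact Real.abs_cos_le_one _
        _ = C * C := by ring

end General

/-- Lebesgue measure on `(-1,1]`. -/
noncomputable abbrev symmVol : Measure ℝ := volume.restrict (Ioc (-1) 1)

instance : IsFiniteMeasure symmVol := by unfold symmVol; infer_instance

lemma integral_symmVol (f : ℝ → ℝ) : ∫ t, f t ∂symmVol = ∫ t in (-1)..1, f t :=
  (intervalIntegral.integral_of_le (by norm_num)).symm

/-- The triangle function. -/
noncomputable def triangle (t : ℝ) : ℝ := max (1 - |t|) 0

lemma measurable_triangle : Measurable triangle := by unfold triangle; fun_prop

lemma triangle_nonneg (t : ℝ) : 0 ≤ triangle t := le_max_right _ _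

lemma triangle_le_one (t : ℝ) : triangle t ≤ 1 :=
  max_le (by linarith [abs_nonneg t]) zero_le_one

lemma abs_triangle_le_one (t : ℝ) : |triangle t| ≤ 1 := by
  rw [abs_of_nonneg (triangle_nonneg t)]; exact triangle_le_one t

lemma integral_triangle_mul (f : ℝ → ℝ) :
    ∫ t, triangle t * f t ∂symmVol = ∫ t in (-1)..1, (1 - |t|) * f t := by
  rw [integral_symmVol]
  refine intervalIntegral.integral_congr fun t ht => ?_
  rw [uIcc_of_le (by norm_num)] at ht
  simp only [triangle, max_eq_left (sub_nonneg.2 (abs_le.2 ht))]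

lemma integral_triangle_mul_cos (x : ℝ) :
    ∫ t, triangle t * Real.cos (x * t) ∂symmVol = fejer x := integral_triangle_mul _

lemma integral_triangle_mul_triangle_mul_cos (x y : ℝ) :
    ∫ t, triangle t.1 * triangle t.2 * Real.cos (x * t.1 + y * t.2) ∂symmVol.prod symmVol =
      fejer x * fejer y := by
  have hm := measurable_triangle
  have h1 : Integrable (fun t : ℝ × ℝ => (triangle t.1 * Real.cos (x * t.1)) *
      (triangle t.2 * Real.cos (y * t.2))) (symmVol.prod symmVol) := by
    refine Integrable.mul_prod (f := fun t => triangle t * Real.cos (x * t))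
      (g := fun t => triangle t * Real.cos (y * t)) ?_ ?_ <;>
    · refine Integrable.of_bound (C := 1) (by fun_prop) (.of_forall fun t => ?_)
      rw [norm_mul]
      exact mul_le_one₀ (abs_triangle_le_one _) (norm_nonneg _) (Real.abs_cos_le_one _)
  have h2 : Integrable (fun t : ℝ × ℝ => (triangle t.1 * Real.sin (x * t.1)) *
      (triangle t.2 * Real.sin (y * t.2))) (symmVol.prod symmVol) := by
    refine Integrable.mul_prod (f := fun t => triangle t * Real.sin (x * t))
      (g := fun t => triangle t * Real.sin (y * t)) ?_ ?_ <;>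
    · refine Integrable.of_bound (C := 1) (by fun_prop) (.of_forall fun t => ?_)
      rw [norm_mul]
      exact mul_le_one₀ (abs_triangle_le_one _) (norm_nonneg _) (Real.abs_sin_le_one _)
  rw [integral_congr_ae (g := fun t : ℝ × ℝ => (triangle t.1 * Real.cos (x * t.1)) *
      (triangle t.2 * Real.cos (y * t.2)) - (triangle t.1 * Real.sin (x * t.1)) *
      (triangle t.2 * Real.sin (y * t.2))) (.of_forall fun t => by
        dsimp only; rw [Real.cos_add]; ring), integral_sub h1 h2,
    integral_prod_mul (fun t => triangle t * Real.cos (x * t))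
      (fun t => triangle t * Real.cos (y * t)),
    integral_prod_mul (fun t => triangle t * Real.sin (x * t))
      (fun t => triangle t * Real.sin (y * t)), integral_triangle_mul_cos,
    integral_triangle_mul_cos, integral_triangle_mul, integral_triangle_mul_sin]
  ring

/-! ### Comparison of correlation integrals with mass in grid cells -/

section Cells

variable {Ω : Type*} [MeasurableSpace Ω]

lemma prod_sub_eq_le_two_mul (P : Measure Ω) [IsFiniteMeasure P] {G : Type*} [AddCommGroup G]
    [Countable G] [MeasurableSpace G] [DiscreteMeasurableSpace G] {k : Ω → G} (hk : Measurable k)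
    (δ : G) :
    (P.prod P) {z | k z.1 - k z.2 = δ} ≤ 2 * (P.prod P) {z | k z.1 = k z.2} := by
  set φ : G → ENNReal := fun q => P (k ⁻¹' {q}) with hφ
  have key (ε : G) : (P.prod P) {z | k z.1 - k z.2 = ε} = ∑' q, φ (q - ε) * φ q := by
    have hs : MeasurableSet {z : Ω × Ω | k z.1 - k z.2 = ε} :=
      ((hk.comp measurable_fst).prodMk (hk.comp measurable_snd))
        (MeasurableSet.of_discrete (s := {q : G × G | q.1 - q.2 = ε}))
    have hfib (u : Ω) : P (Prod.mk u ⁻¹' {z : Ω × Ω | k z.1 - k z.2 = ε}) = φ (k u - ε) := by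
      rw [hφ]
      congr 1
      ext v
      simp only [mem_preimage, mem_ofPred_eq, mem_singleton_iff]
      exact ⟨fun h => by rw [← h]; abel, fun h => by rw [h]; abel⟩
    rw [Measure.prod_apply hs]
    simp only [hfib]
    rw [← lintegral_map (f := fun q => φ (q - ε)) (.of_discrete) hk, lintegral_countable']
    refine tsum_congr fun q => ?_
    rw [Measure.map_apply hk (.of_discrete)]
  have h0 : (P.prod P) {z | k z.1 = k z.2} = ∑' q, φ q * φ q := by
    simpa [sub_eq_zero] using key 0
  rw [key, h0]
  calc ∑' q, φ (q - δ) * φ q ≤ ∑' q, (φ (q - δ) * φ (q - δ) + φ q * φ q) := by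
        refine ENNReal.tsum_le_tsum fun q => ?_
        rcases le_total (φ (q - δ)) (φ q) with h | h
        · exact (mul_le_mul_left h _).trans le_add_self
        · exact (mul_le_mul_right h _).trans le_self_add
    _ = 2 * ∑' q, φ q * φ q := by
        have h := (Equiv.subRight δ).tsum_eq fun q => φ q * φ q
        simp only [Equiv.subRight_apply] at h
        rw [ENNReal.tsum_add, h, two_mul]

lemma lintegral_le_tsum_mul_prod (P : Measure Ω) [IsFiniteMeasure P] {G : Type*} [AddCommGroup G]
    [Countable G] [MeasurableSpace G] [DiscreteMeasurableSpace G] {k : Ω → G} (hk : Measurable k)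
    (ω : G → ENNReal) {f : Ω × Ω → ENNReal} (hf : ∀ z, f z ≤ ω (k z.1 - k z.2)) :
    ∫⁻ z, f z ∂P.prod P ≤ 2 * (∑' δ, ω δ) * (P.prod P) {z | k z.1 = k z.2} := by
  have hm : Measurable fun z : Ω × Ω => k z.1 - k z.2 :=
    (Measurable.of_discrete (f := fun q : G × G => q.1 - q.2)).comp
      ((hk.comp measurable_fst).prodMk (hk.comp measurable_snd))
  calc ∫⁻ z, f z ∂P.prod P ≤ ∫⁻ z, ω (k z.1 - k z.2) ∂P.prod P := lintegral_mono hf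
    _ = ∑' δ, ω δ * (P.prod P) {z | k z.1 - k z.2 = δ} := by
        rw [← lintegral_map (f := ω) (.of_discrete) hm, lintegral_countable']
        refine tsum_congr fun q => ?_
        rw [Measure.map_apply hm (.of_discrete)]
        rfl
    _ ≤ ∑' δ, ω δ * (2 * (P.prod P) {z | k z.1 = k z.2}) := by
        gcongr with δ
        exact prod_sub_eq_le_two_mul P hk δ
    _ = 2 * (∑' δ, ω δ) * (P.prod P) {z | k z.1 = k z.2} := by
        rw [ENNReal.tsum_mul_right]; ring

end Cells

lemma fejer_mul_le {h A : ℝ} (h0 : 0 ≤ h) (hA : h ≤ A) (x y : ℝ) :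
    fejer (A * (x - y)) ≤ 15 / (1 + ((⌊h * x⌋ - ⌊h * y⌋ : ℤ) : ℝ) ^ 2) := by
  refine (fejer_le _).trans ?_
  rw [div_le_div_iff₀ (by positivity) (by positivity)]
  have h1 := Int.floor_le (h * x)
  have h2 := Int.lt_floor_add_one (h * x)
  have h3 := Int.floor_le (h * y)
  have h4 := Int.lt_floor_add_one (h * y)
  push_cast
  set p : ℝ := (⌊h * x⌋ : ℝ)
  set q : ℝ := (⌊h * y⌋ : ℝ)
  have h5 : (h * (x - y)) ^ 2 ≤ (A * (x - y)) ^ 2 := by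
    rw [mul_pow, mul_pow]; gcongr
  have h6 : (p - q - h * (x - y)) ^ 2 ≤ 1 := by
    rw [sq_le_one_iff_abs_le_one, abs_le]; constructor <;> nlinarith
  nlinarith [sq_nonneg (p - q - 2 * (h * (x - y)))]

/-- The constant in the comparison of Fejér correlations with cell masses. -/
noncomputable def cellConst : ENNReal :=
  2 * (∑' n : ℤ, ENNReal.ofReal (15 / (1 + (n : ℝ) ^ 2))) ^ 2

lemma cellConst_ne_top : cellConst ≠ ⊤ := by
  have hs : Summable fun n : ℤ => 15 / (1 + (n : ℝ) ^ 2) := by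
    have h1 : Summable fun n : ℤ => 15 * (1 / (n : ℝ) ^ 2) :=
      (Real.summable_one_div_int_pow.2 one_lt_two).mul_left 15
    refine (h1.add (summable_of_hasFiniteSupport (f := fun n : ℤ => if n = 0 then (15 : ℝ) else 0)
      ((finite_singleton 0).subset fun n hn => by simpa using hn))).of_nonneg_of_le
      (fun n => by positivity) fun n => ?_
    rcases eq_or_ne n 0 with rfl | hn
    · simp
    · have : 0 < (n : ℝ) ^ 2 := by positivity
      rw [if_neg hn, add_zero, mul_one_div]
      gcongr
      linarith
  have : ∑' n : ℤ, ENNReal.ofReal (15 / (1 + (n : ℝ) ^ 2)) ≠ ⊤ := by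
    rw [← ENNReal.ofReal_tsum_of_nonneg (fun n => by positivity) hs]
    exact ENNReal.ofReal_ne_top
  exact ENNReal.mul_ne_top (by simp) (ENNReal.pow_ne_top this)

section

variable {α : ℝ}

lemma measurable_slantedTakagi (h0 : 0 < α) (h1 : α < 1) (s : ℝ) :
    Measurable (slantedTakagi α s) :=
  ((continuous_takagi h0 h1).add (continuous_const.mul continuous_id)).measurable

lemma measurableSet_pair (h0 : 0 < α) (h1 : α < 1) (N : ℕ) (s ρ : ℝ) :
    MeasurableSet {z : ℝ × ℝ | ⌊2 ^ N * z.1⌋ = ⌊2 ^ N * z.2⌋ ∧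
      |slantedTakagi α s z.1 - slantedTakagi α s z.2| ≤ ρ} := by
  have hm := measurable_slantedTakagi h0 h1 s
  refine MeasurableSet.inter (s₁ := {z : ℝ × ℝ | ⌊2 ^ N * z.1⌋ = ⌊2 ^ N * z.2⌋})
    (s₂ := {z | |slantedTakagi α s z.1 - slantedTakagi α s z.2| ≤ ρ})
    (measurableSet_eq_fun ?_ ?_) (measurableSet_le ?_ measurable_const)
  · exact Int.measurable_floor.comp (by fun_prop)
  · exact Int.measurable_floor.comp (by fun_prop)
  · exact ((hm.comp measurable_fst).sub (hm.comp measurable_snd)).abs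

lemma pairMass_eq_prod (h0 : 0 < α) (h1 : α < 1) (N : ℕ) (s ρ : ℝ) :
    pairMass α N s ρ = (unitVol.prod unitVol) {z : ℝ × ℝ | ⌊2 ^ N * z.1⌋ = ⌊2 ^ N * z.2⌋ ∧
      |slantedTakagi α s z.1 - slantedTakagi α s z.2| ≤ ρ} := by
  have hs := measurableSet_pair h0 h1 N s ρ
  rw [← lintegral_indicator_one hs, lintegral_prod _ ((measurable_one.indicator hs).aemeasurable),
    pairMass]
  simp only [indicator_apply, mem_ofPred_eq, Pi.one_apply]

/-- Fejér-weighted correlations of the graph are controlled by `pairMass`. -/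
lemma lintegral_fejer_mul_fejer_le (h0 : 0 < α) (h1 : α < 1) (n : ℕ) {A : ℝ} (hA : 2 ^ n ≤ A) :
    ∫⁻ z, ENNReal.ofReal (fejer (A * (z.1 - z.2)) * fejer (A * (takagi α z.1 - takagi α z.2)))
      ∂unitVol.prod unitVol ≤ cellConst * pairMass α n 0 ((1 / 2) ^ n) := by
  have hT := (continuous_takagi h0 h1).measurable
  set k : ℝ → ℤ × ℤ := fun u => (⌊2 ^ n * u⌋, ⌊2 ^ n * takagi α u⌋) with hk
  have hkm : Measurable k :=
    (Int.measurable_floor.comp (by fun_prop)).prodMk (Int.measurable_floor.comp (by fun_prop))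
  set ω : ℤ × ℤ → ENNReal := fun δ => ENNReal.ofReal (15 / (1 + (δ.1 : ℝ) ^ 2)) *
    ENNReal.ofReal (15 / (1 + (δ.2 : ℝ) ^ 2)) with hω
  have hsum : 2 * ∑' δ, ω δ = cellConst := by
    rw [ENNReal.tsum_prod', cellConst, sq]
    simp only [hω, ENNReal.tsum_mul_left, ENNReal.tsum_mul_right]
  refine (lintegral_le_tsum_mul_prod unitVol hkm ω fun z => ?_).trans ?_
  · rw [ENNReal.ofReal_mul (fejer_nonneg _)]
    exact mul_le_mul' (ENNReal.ofReal_le_ofReal (fejer_mul_le (by positivity) hA _ _))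
      (ENNReal.ofReal_le_ofReal (fejer_mul_le (by positivity) hA _ _))
  · rw [hsum, pairMass_eq_prod h0 h1]
    refine mul_le_mul_right (measure_mono fun z hz => ?_) _
    obtain ⟨h2, h3⟩ := Prod.ext_iff.1 (hz : k z.1 = k z.2)
    refine ⟨h2, ?_⟩
    have h4 := (Int.abs_sub_lt_one_of_floor_eq_floor h3).le
    rw [← mul_sub, abs_mul, abs_of_pos (by positivity), ← le_div_iff₀' (by positivity)] at h4
    simpa [slantedTakagi] using h4

end

/-! ### Exponential sums along the graph -/

lemma lintegral_sq_le_of_isProbabilityMeasure {Ω : Type*} [MeasurableSpace Ω] (P : Measure Ω)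
    [IsProbabilityMeasure P] {f : Ω → ENNReal} (hf : AEMeasurable f P) :
    (∫⁻ x, f x ∂P) ^ 2 ≤ ∫⁻ x, f x ^ 2 ∂P := by
  have h := ENNReal.lintegral_mul_le_Lp_mul_Lq P Real.HolderConjugate.two_two hf
    (aemeasurable_const (b := (1 : ENNReal)))
  simp only [Pi.mul_apply, mul_one, ENNReal.rpow_two, one_pow, lintegral_one, measure_univ,
    ENNReal.one_rpow] at h
  calc (∫⁻ x, f x ∂P) ^ 2 ≤ ((∫⁻ x, f x ^ 2 ∂P) ^ (1 / 2 : ℝ)) ^ 2 := by gcongr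
    _ = ∫⁻ x, f x ^ 2 ∂P := by
        rw [← ENNReal.rpow_two, ← ENNReal.rpow_mul]; norm_num

/-- The reciprocal of `sinc (u / 2)`, truncated to be bounded. -/
noncomputable def sincWeight (u : ℝ) : ℝ := (max (Real.sinc (u / 2)) (1 / 2))⁻¹

lemma continuous_sincWeight : Continuous sincWeight :=
  ((Real.continuous_sinc.comp (by fun_prop)).max continuous_const).inv₀
    fun x => (lt_of_lt_of_le (by norm_num) (le_max_right _ _)).ne'

lemma sincWeight_nonneg (u : ℝ) : 0 ≤ sincWeight u :=
  inv_nonneg.2 (le_trans (by norm_num) (le_max_right _ _))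

lemma abs_sincWeight_le (u : ℝ) : |sincWeight u| ≤ 2 := by
  rw [abs_of_nonneg (sincWeight_nonneg u), sincWeight]
  exact inv_le_of_inv_le₀ two_pos ((by norm_num : (2 : ℝ)⁻¹ ≤ 1 / 2).trans (le_max_right _ _))

lemma sincWeight_mul_sinc {u : ℝ} (hu : u ∈ Ico (0 : ℝ) 1) :
    sincWeight u * Real.sinc (u / 2) = 1 := by
  have h : 1 / 2 ≤ Real.sinc (u / 2) := by
    rcases hu.1.eq_or_lt with rfl | h0
    · simp; norm_num
    · rw [Real.sinc_of_ne_zero (by positivity), le_div_iff₀ (by positivity)]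
      have := Real.sin_gt_sub_cube (x := u / 2) (by linarith)
      have h2 : u ^ 2 ≤ 1 := pow_le_one₀ h0.le hu.2.le
      nlinarith
  rw [sincWeight, max_eq_left h]
  exact inv_mul_cancel₀ (by linarith)

/-- Lebesgue measure on an interval of length one centred at the origin. -/
noncomputable abbrev centredVol : Measure ℝ := volume.restrict (Ioc (-(1 / 2)) (1 / 2))

instance : IsProbabilityMeasure centredVol :=
  ⟨by simp only [centredVol, Measure.restrict_apply_univ, Real.volume_Ioc]; norm_num⟩

lemma integral_centredVol_exp (u : ℝ) :
    ∫ τ, Complex.exp ((τ * u : ℝ) * Complex.I) ∂centredVol = Real.sinc (u / 2) := by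
  rw [← intervalIntegral.integral_of_le (by norm_num)]
  rcases eq_or_ne u 0 with rfl | hu
  · simp; norm_num
  · have h : (Complex.I * u : ℂ) ≠ 0 := by simp [hu]
    have h1 : ∀ τ : ℝ, ((τ * u : ℝ) * Complex.I : ℂ) = (Complex.I * u) * τ := fun τ => by
      push_cast; ring
    simp only [h1]
    rw [integral_exp_mul_complex h, Real.sinc_of_ne_zero (by simpa using hu)]
    push_cast
    have h2 : (Complex.I * u * (1 / 2) : ℂ) = (u / 2) * Complex.I := by ring
    have h3 : (Complex.I * u * -(1 / 2) : ℂ) = -(u / 2) * Complex.I := by ring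
    rw [h2, h3, Complex.exp_mul_I, Complex.exp_mul_I, Complex.cos_neg, Complex.sin_neg]
    field_simp
    ring

/-- The weighted Fourier transform of Lebesgue measure lifted to the graph. -/
noncomputable def graphFourier (α ξ η : ℝ) : ℂ :=
  ∫ u, (sincWeight u : ℂ) * Complex.exp ((ξ * u + η * takagi α u : ℝ) * Complex.I) ∂unitVol

/-- The Fourier transform of the distribution of `slantedTakagi α s`. -/
noncomputable def slantFourier (α s η : ℝ) : ℂ :=
  ∫ u, ((1 : ℝ) : ℂ) * Complex.exp ((η * slantedTakagi α s u : ℝ) * Complex.I) ∂unitVol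

section

variable {α : ℝ}

lemma continuous_graphFourier (h0 : 0 < α) (h1 : α < 1) :
    Continuous fun p : ℝ × ℝ => graphFourier α p.1 p.2 := by
  have hT := continuous_takagi h0 h1
  have hb := continuous_sincWeight
  refine continuous_of_dominated (bound := fun _ => 2) (fun p => ?_)
    (fun p => .of_forall fun u => ?_) (integrable_const _) (.of_forall fun u => ?_)
  · exact Continuous.aestronglyMeasurable (by fun_prop)
  · rw [norm_mul, Complex.norm_exp_ofReal_mul_I, mul_one, Complex.norm_real]
    exact abs_sincWeight_le u
  · fun_prop

lemma continuous_slantFourier (h0 : 0 < α) (h1 : α < 1) (s : ℝ) :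
    Continuous (slantFourier α s) := by
  have hm := measurable_slantedTakagi h0 h1 s
  refine continuous_of_dominated (bound := fun _ => 1) (fun p => ?_)
    (fun p => .of_forall fun u => ?_) (integrable_const _) (.of_forall fun u => ?_)
  · exact Measurable.aestronglyMeasurable (by fun_prop)
  · rw [norm_mul, Complex.norm_exp_ofReal_mul_I]; simp
  · fun_prop

lemma enorm_slantFourier_le (s η : ℝ) : ‖slantFourier α s η‖ₑ ≤ 1 := by
  have h : ‖slantFourier α s η‖ ≤ 1 * unitVol.real univ :=
    norm_integral_le_of_norm_le_const (.of_forall fun u => by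
      rw [norm_mul, Complex.norm_exp_ofReal_mul_I]; simp)
  rw [← ofReal_norm]
  simpa using ENNReal.ofReal_le_ofReal h

lemma slantFourier_eq_integral (h0 : 0 < α) (h1 : α < 1) (s η : ℝ) :
    slantFourier α s η = ∫ τ, graphFourier α (η * s + τ) η ∂centredVol := by
  have hT := continuous_takagi h0 h1
  have hb := continuous_sincWeight
  simp only [graphFourier]
  rw [integral_integral_swap]
  · rw [slantFourier]
    refine integral_congr_ae ?_
    filter_upwards [ae_unitVol_mem] with u hu
    have h2 (τ : ℝ) : (sincWeight u : ℂ) *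
        Complex.exp (((η * s + τ) * u + η * takagi α u : ℝ) * Complex.I) =
        (sincWeight u : ℂ) * Complex.exp ((η * slantedTakagi α s u : ℝ) * Complex.I) *
        Complex.exp ((τ * u : ℝ) * Complex.I) := by
      rw [mul_assoc, ← Complex.exp_add, slantedTakagi]
      push_cast
      ring_nf
    simp only [h2]
    rw [integral_const_mul, integral_centredVol_exp, mul_right_comm, ← Complex.ofReal_mul,
      sincWeight_mul_sinc hu]
  · refine Integrable.of_bound (Continuous.aestronglyMeasurable
      (by simp only [Function.uncurry_def]; fun_prop)) 2 (.of_forall fun z => ?_)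
    simp only [Function.uncurry_def]
    rw [norm_mul, Complex.norm_exp_ofReal_mul_I, mul_one, Complex.norm_real]
    exact abs_sincWeight_le _

/-- A large sieve inequality comparing `slantFourier` with a local average of `graphFourier`. -/
lemma enorm_slantFourier_sq_le (h0 : 0 < α) (h1 : α < 1) (s η : ℝ) :
    ‖slantFourier α s η‖ₑ ^ 2 ≤
      ∫⁻ ξ in Ioc (η * s - 1 / 2) (η * s + 1 / 2), ‖graphFourier α ξ η‖ₑ ^ 2 := by
  have hc := continuous_graphFourier h0 h1
  have hcτ : Continuous fun ξ => graphFourier α ξ η := hc.comp (by fun_prop : Continuous (·, η))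
  calc ‖slantFourier α s η‖ₑ ^ 2 ≤ (∫⁻ τ, ‖graphFourier α (η * s + τ) η‖ₑ ∂centredVol) ^ 2 := by
        rw [slantFourier_eq_integral h0 h1]
        gcongr
        exact enorm_integral_le_lintegral_enorm _
    _ ≤ ∫⁻ τ, ‖graphFourier α (η * s + τ) η‖ₑ ^ 2 ∂centredVol :=
        lintegral_sq_le_of_isProbabilityMeasure _
          (Continuous.aemeasurable (hcτ.comp (by fun_prop)).enorm)
    _ = _ := by
        rw [centredVol, ← lintegral_indicator measurableSet_Ioc,
          ← lintegral_indicator measurableSet_Ioc, 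
          ← lintegral_add_left_eq_self ((Ioc (η * s - 1 / 2) (η * s + 1 / 2)).indicator _) (η * s)]
        congr 1 with τ
        have : η * s + τ ∈ Ioc (η * s - 1 / 2) (η * s + 1 / 2) ↔ τ ∈ Ioc (-(1 / 2) : ℝ) (1 / 2) := by
          simp only [mem_Ioc]
          constructor <;> rintro ⟨h3, h4⟩ <;> constructor <;> linarith
        simp only [indicator_apply, this]

end

lemma lintegral_symmVol_comp_mul {c : ℝ} (hc : 0 < c) {f : ℝ → ENNReal} (hf : Measurable f) :
    ENNReal.ofReal c * ∫⁻ t, f (c * t) ∂symmVol = ∫⁻ η in Ioc (-c) c, f η := by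
  rw [symmVol, ← lintegral_indicator measurableSet_Ioc, ← lintegral_indicator measurableSet_Ioc]
  conv_rhs =>
    rw [← Real.smul_map_volume_mul_left hc.ne', lintegral_smul_measure,
      lintegral_map (hf.indicator measurableSet_Ioc) (by fun_prop), abs_of_pos hc, smul_eq_mul]
  congr 2 with t
  have : c * t ∈ Ioc (-c) c ↔ t ∈ Ioc (-1 : ℝ) 1 := by
    simp only [mem_Ioc]
    constructor <;> rintro ⟨h3, h4⟩ <;> constructor <;> nlinarith
  simp only [indicator_apply, this]

lemma lintegral_Ioc_le_triangle {B : ℝ} (hB : 0 < B) {f : ℝ → ENNReal} (hf : Measurable f) :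
    ∫⁻ η in Ioc (-B) B, f η ≤
      ENNReal.ofReal (4 * B) * ∫⁻ t, ENNReal.ofReal (triangle t) * f (2 * B * t) ∂symmVol := by
  have hm := measurable_triangle
  have h2 : (2 : ENNReal) = ENNReal.ofReal 2 := by simp
  calc ∫⁻ η in Ioc (-B) B, f η
      ≤ ∫⁻ η in Ioc (-B) B, 2 * (ENNReal.ofReal (triangle (η / (2 * B))) * f η) := by
        refine setLIntegral_mono (by fun_prop) fun η hη => ?_
        rw [← mul_assoc, h2, ← ENNReal.ofReal_mul zero_le_two]
        refine le_mul_of_one_le_left' (ENNReal.one_le_ofReal.2 ?_)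
        have : |η / (2 * B)| ≤ 1 / 2 := by
          rw [abs_div, abs_of_pos (by positivity : 0 < 2 * B), div_le_iff₀ (by positivity)]
          linarith [abs_le.2 ⟨hη.1.le, hη.2⟩]
        have h3 : 1 - |η / (2 * B)| ≤ triangle (η / (2 * B)) := le_max_left _ _
        linarith
    _ ≤ ∫⁻ η in Ioc (-(2 * B)) (2 * B), 2 * (ENNReal.ofReal (triangle (η / (2 * B))) * f η) :=
        lintegral_mono_set (Ioc_subset_Ioc (by linarith) (by linarith))
    _ = _ := by
        rw [← lintegral_symmVol_comp_mul (by positivity) (by fun_prop),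
          lintegral_const_mul _ (by fun_prop), ← mul_assoc, h2, ← ENNReal.ofReal_mul (by positivity)]
        congr 1
        · ring_nf
        · congr 1 with t
          rw [mul_div_cancel_left₀ _ (by positivity)]

lemma lintegral_ofReal_eq_ofReal_integral {Ω : Type*} [MeasurableSpace Ω] {P : Measure Ω}
    {f : Ω → ℝ} (hf : Integrable f P) (h0 : ∀ x, 0 ≤ f x) :
    ∫⁻ x, ENNReal.ofReal (f x) ∂P = ENNReal.ofReal (∫ x, f x ∂P) :=
  (ofReal_integral_eq_lintegral_ofReal hf (.of_forall h0)).symm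

lemma enorm_sq_eq_ofReal (z : ℂ) : ‖z‖ₑ ^ 2 = ENNReal.ofReal (‖z‖ ^ 2) := by
  rw [ENNReal.ofReal_pow (norm_nonneg z), ofReal_norm]

lemma ofReal_integral_le_lintegral {Ω : Type*} [MeasurableSpace Ω] {P : Measure Ω} (f : Ω → ℝ) :
    ENNReal.ofReal (∫ x, f x ∂P) ≤ ∫⁻ x, ENNReal.ofReal (f x) ∂P := by
  by_cases hf : Integrable f P
  · rw [integral_eq_lintegral_pos_part_sub_lintegral_neg_part hf]
    exact (ENNReal.ofReal_le_ofReal (sub_le_self _ ENNReal.toReal_nonneg)).trans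
      ENNReal.ofReal_toReal_le
  · simp [integral_undef hf]

section

variable {α : ℝ}

lemma pairMass_zero_le (h0 : 0 < α) (h1 : α < 1) (s : ℝ) {c : ℝ} (hc : 0 < c) :
    pairMass α 0 s c⁻¹ ≤ 2 * (ENNReal.ofReal c)⁻¹ *
      ∫⁻ η in Ioc (-c) c, ‖slantFourier α s η‖ₑ ^ 2 := by
  have hm := measurable_slantedTakagi h0 h1 s
  have hΦ := continuous_slantFourier h0 h1 s
  have ht := measurable_triangle
  have hf : Continuous fejer := by
    unfold fejer
    exact intervalIntegral.continuous_parametric_intervalIntegral_of_continuous' (by fun_prop) _ _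
  set X : ℝ × ℝ → ℝ := fun z => c * (slantedTakagi α s z.1 - slantedTakagi α s z.2)
  have hX : Measurable X := by fun_prop
  have key : ∫ z, fejer (X z) ∂unitVol.prod unitVol =
      ∫ t, triangle t * ‖slantFourier α s (c * t)‖ ^ 2 ∂symmVol := by
    have h := integral_weight_mul_norm_integral_exp_sq unitVol symmVol (w := triangle)
      (b := fun _ => 1) (p := fun t u => c * t * slantedTakagi α s u) (C := 1) ht
      abs_triangle_le_one measurable_const (by simp) (by
        simp only [Function.uncurry_def]; fun_prop)
    simp only [slantFourier]
    rw [h]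
    refine integral_congr_ae (.of_forall fun z => ?_)
    dsimp only
    rw [← integral_triangle_mul_cos, one_mul, one_mul]
    congr 1 with t
    ring_nf
    simp only [X]
    ring_nf
  calc pairMass α 0 s c⁻¹
      ≤ (unitVol.prod unitVol) {z | 1 ≤ ENNReal.ofReal (2 * fejer (X z))} := by
        rw [pairMass_eq_prod h0 h1]
        refine measure_mono fun z hz => ?_
        have h2 : |X z| ≤ 1 := by
          rw [abs_mul, abs_of_pos hc]
          calc _ ≤ c * c⁻¹ := by gcongr; exact hz.2
            _ = 1 := mul_inv_cancel₀ hc.ne'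
        exact ENNReal.one_le_ofReal.2 (by linarith [half_le_fejer h2])
    _ ≤ ∫⁻ z, ENNReal.ofReal (2 * fejer (X z)) ∂unitVol.prod unitVol := by
        simpa using mul_meas_ge_le_lintegral (μ := unitVol.prod unitVol)
          (f := fun z => ENNReal.ofReal (2 * fejer (X z)))
          (by have := hf.measurable; fun_prop) 1
    _ = 2 * ENNReal.ofReal (∫ z, fejer (X z) ∂unitVol.prod unitVol) := by
        rw [lintegral_ofReal_eq_ofReal_integral, integral_const_mul,
          ENNReal.ofReal_mul zero_le_two, ENNReal.ofReal_ofNat]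
        · refine Integrable.of_bound (hf.measurable.comp hX |>.const_mul 2).aestronglyMeasurable 10
            (.of_forall fun z => ?_)
          rw [Real.norm_of_nonneg (by have := fejer_nonneg (X z); positivity)]
          have h3 : 5 / (1 + X z ^ 2) ≤ 5 := div_le_self (by norm_num) (by nlinarith [sq_nonneg (X z)])
          linarith [fejer_le (X z)]
        · exact fun z => mul_nonneg zero_le_two (fejer_nonneg _)
    _ ≤ 2 * ∫⁻ t, ‖slantFourier α s (c * t)‖ₑ ^ 2 ∂symmVol := by
        rw [key]
        refine mul_le_mul_right (le_trans ?_ (lintegral_mono (μ := symmVol)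
          (f := fun t => ENNReal.ofReal (triangle t * ‖slantFourier α s (c * t)‖ ^ 2)) fun t => ?_)) _
        · exact ofReal_integral_le_lintegral _
        · dsimp only
          rw [enorm_sq_eq_ofReal]
          exact ENNReal.ofReal_le_ofReal
            (mul_le_of_le_one_left (sq_nonneg _) (triangle_le_one t))
    _ = _ := by
        rw [← lintegral_symmVol_comp_mul hc (f := fun η => ‖slantFourier α s η‖ₑ ^ 2)
          (by fun_prop), ← mul_assoc, mul_assoc 2, ENNReal.inv_mul_cancel (by simpa using hc)
          ENNReal.ofReal_ne_top, mul_one]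

/-- The energy of the graph on a square of frequencies is controlled by `pairMass`. -/
lemma lintegral_graphFourier_le (h0 : 0 < α) (h1 : α < 1) (n : ℕ) {B : ℝ} (hB : 2 ^ n ≤ 2 * B) :
    ∫⁻ η in Ioc (-B) B, ∫⁻ ξ in Ioc (-B) B, ‖graphFourier α ξ η‖ₑ ^ 2 ≤
      ENNReal.ofReal (64 * B ^ 2) * (cellConst * pairMass α n 0 ((1 / 2) ^ n)) := by
  have hB0 : 0 < B := by have : (0 : ℝ) < 2 ^ n := by positivity
                         linarith
  have hH := continuous_graphFourier h0 h1
  have hT := (continuous_takagi h0 h1).measurable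
  have hb := continuous_sincWeight.measurable
  have ht := measurable_triangle
  set E : ℝ × ℝ → ENNReal := fun p => ‖graphFourier α p.1 p.2‖ₑ ^ 2
  have hE : Measurable E := hH.measurable.enorm.pow_const 2
  have hEle (p : ℝ × ℝ) : ‖graphFourier α p.1 p.2‖ ≤ 2 := by
    have := norm_integral_le_of_norm_le_const (μ := unitVol) (C := 2) (f := fun u =>
      (sincWeight u : ℂ) * Complex.exp ((p.1 * u + p.2 * takagi α u : ℝ) * Complex.I))
      (.of_forall fun u => by
        rw [norm_mul, Complex.norm_exp_ofReal_mul_I, mul_one, Complex.norm_real]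
        exact abs_sincWeight_le u)
    simpa [graphFourier] using this
  set F : ℝ × ℝ → ℝ := fun t => triangle t.1 * triangle t.2 *
    ‖graphFourier α (2 * B * t.1) (2 * B * t.2)‖ ^ 2 with hF
  have hF0 (t) : 0 ≤ F t :=
    mul_nonneg (mul_nonneg (triangle_nonneg _) (triangle_nonneg _)) (sq_nonneg _)
  have hFm : Measurable F := by
    have : Measurable fun t : ℝ × ℝ => graphFourier α (2 * B * t.1) (2 * B * t.2) :=
      hH.measurable.comp (by fun_prop : Measurable fun t : ℝ × ℝ => (2 * B * t.1, 2 * B * t.2))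
    fun_prop
  have key : ∫ t, F t ∂symmVol.prod symmVol =
      ∫ z, sincWeight z.1 * sincWeight z.2 * (fejer (2 * B * (z.1 - z.2)) *
        fejer (2 * B * (takagi α z.1 - takagi α z.2))) ∂unitVol.prod unitVol := by
    have h := integral_weight_mul_norm_integral_exp_sq unitVol (symmVol.prod symmVol)
      (w := fun t => triangle t.1 * triangle t.2)
      (b := sincWeight) (p := fun t u => 2 * B * t.1 * u + 2 * B * t.2 * takagi α u) (C := 2)
      (by fun_prop) (fun t => by
        rw [abs_mul]
        exact mul_le_one₀ (abs_triangle_le_one _) (abs_nonneg _) (abs_triangle_le_one _)) hb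
      abs_sincWeight_le (by simp only [Function.uncurry_def]; fun_prop)
    simp only [hF, graphFourier]
    rw [h]
    refine integral_congr_ae (.of_forall fun z => ?_)
    dsimp only
    rw [← integral_triangle_mul_triangle_mul_cos]
    congr 2 with t
    ring_nf
  calc ∫⁻ η in Ioc (-B) B, ∫⁻ ξ in Ioc (-B) B, E (ξ, η)
      ≤ ∫⁻ η in Ioc (-B) B, ENNReal.ofReal (4 * B) *
          ∫⁻ t, ENNReal.ofReal (triangle t) * E (2 * B * t, η) ∂symmVol :=
        lintegral_mono fun η => lintegral_Ioc_le_triangle hB0 (f := fun ξ => E (ξ, η))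
          (by fun_prop)
    _ ≤ ENNReal.ofReal (4 * B) * ∫⁻ t', ENNReal.ofReal (triangle t') * (ENNReal.ofReal (4 * B) *
          ∫⁻ t, ENNReal.ofReal (triangle t) * E (2 * B * t, 2 * B * t') ∂symmVol) ∂symmVol :=
        lintegral_Ioc_le_triangle hB0 ((Measurable.lintegral_prod_left'
          (f := fun q : ℝ × ℝ => ENNReal.ofReal (triangle q.1) * E (2 * B * q.1, q.2))
          (by fun_prop)).const_mul _)
    _ = ENNReal.ofReal (16 * B ^ 2) *
          ∫⁻ t', ∫⁻ t, ENNReal.ofReal (F (t, t')) ∂symmVol ∂symmVol := by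
        have h2 (t' : ℝ) : ENNReal.ofReal (triangle t') * (ENNReal.ofReal (4 * B) *
            ∫⁻ t, ENNReal.ofReal (triangle t) * E (2 * B * t, 2 * B * t') ∂symmVol) =
            ENNReal.ofReal (4 * B) * ∫⁻ t, ENNReal.ofReal (F (t, t')) ∂symmVol := by
          rw [mul_left_comm, ← lintegral_const_mul _ (by fun_prop)]
          congr 2 with t
          simp only [hF, E]
          rw [enorm_sq_eq_ofReal, ENNReal.ofReal_mul (mul_nonneg (triangle_nonneg _)
            (triangle_nonneg _)), ENNReal.ofReal_mul (triangle_nonneg _)]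
          ring
        simp only [h2]
        rw [lintegral_const_mul' _ _ ENNReal.ofReal_ne_top, ← mul_assoc,
          ← ENNReal.ofReal_mul (by positivity)]
        ring_nf
    _ = ENNReal.ofReal (16 * B ^ 2) * ENNReal.ofReal (∫ t, F t ∂symmVol.prod symmVol) := by
        rw [← lintegral_ofReal_eq_ofReal_integral _ hF0, lintegral_prod_symm _ (by fun_prop)]
        refine Integrable.of_bound hFm.aestronglyMeasurable 4 (.of_forall fun t => ?_)
        rw [Real.norm_of_nonneg (hF0 t)]
        calc F t ≤ 1 * 1 * 2 ^ 2 := by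
              simp only [hF]
              gcongr
              · exact triangle_nonneg _
              · exact triangle_le_one _
              · exact triangle_le_one _
              · exact hEle (2 * B * t.1, 2 * B * t.2)
          _ = 4 := by norm_num
    _ ≤ ENNReal.ofReal (16 * B ^ 2) * (4 * ∫⁻ z, ENNReal.ofReal (fejer (2 * B * (z.1 - z.2)) *
          fejer (2 * B * (takagi α z.1 - takagi α z.2))) ∂unitVol.prod unitVol) := by
        rw [key]
        refine mul_le_mul_right ?_ _
        rw [← lintegral_const_mul' _ _ (by simp)]
        refine (ofReal_integral_le_lintegral _).trans (lintegral_mono fun z => ?_)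
        rw [← ENNReal.ofReal_ofNat 4, ← ENNReal.ofReal_mul (by norm_num)]
        refine ENNReal.ofReal_le_ofReal (mul_le_mul_of_nonneg_right ?_
          (mul_nonneg (fejer_nonneg _) (fejer_nonneg _)))
        nlinarith [(le_abs_self _).trans (abs_sincWeight_le z.1), sincWeight_nonneg z.1,
          (le_abs_self _).trans (abs_sincWeight_le z.2), sincWeight_nonneg z.2]
    _ ≤ ENNReal.ofReal (16 * B ^ 2) * (4 * (cellConst * pairMass α n 0 ((1 / 2) ^ n))) := by
        gcongr
        exact lintegral_fejer_mul_fejer_le h0 h1 n hB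
    _ = _ := by
        rw [← mul_assoc, ← ENNReal.ofReal_ofNat 4, ← ENNReal.ofReal_mul (by positivity)]
        ring_nf

end

/-! ### The renormalised energy at scale `2⁻ᴺ` -/

/-- The mean energy at frequency `η` of the slanted functions of level `N`. -/
noncomputable def meanEnergy (α : ℝ) (N : ℕ) (η : ℝ) : ENNReal :=
  2⁻¹ ^ N * ∑ S ∈ (Finset.range N).powerset, ‖slantFourier α (signedSum (2 * α)⁻¹ N S) η‖ₑ ^ 2

/-- The total mean energy at the frequencies visible at level `N`. -/
noncomputable def totalEnergy (α : ℝ) (N : ℕ) : ENNReal :=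
  ∫⁻ η in Ioc (-(2 * α) ^ N) ((2 * α) ^ N), meanEnergy α N η

/-- The energy of the graph in a square of frequencies. -/
noncomputable def squareEnergy (α B : ℝ) : ENNReal :=
  ∫⁻ η in Ioc (-B) B, ∫⁻ ξ in Ioc (-B) B, ‖graphFourier α ξ η‖ₑ ^ 2

section

variable {α : ℝ}

lemma meanEnergy_le_one (N : ℕ) (η : ℝ) : meanEnergy α N η ≤ 1 := by
  calc meanEnergy α N η ≤ 2⁻¹ ^ N * ∑ S ∈ (Finset.range N).powerset, 1 := by
        unfold meanEnergy
        gcongr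
        exact pow_le_one₀ zero_le (enorm_slantFourier_le _ _)
    _ = 1 := by
        rw [Finset.sum_const, Finset.card_powerset, Finset.card_range, nsmul_eq_mul, mul_one,
          Nat.cast_pow, Nat.cast_ofNat, ← mul_pow, ENNReal.inv_mul_cancel (by simp) (by simp),
          one_pow]

/-- Self-similarity turns correlations at scale `2⁻ᴺ` into mean energy. -/
lemma pairMass_le_totalEnergy (h0 : 0 < α) (h1 : α < 1) (N : ℕ) :
    pairMass α N 0 ((1 / 2) ^ N) ≤
      2 * ((ENNReal.ofReal (2 * α))⁻¹ ^ N * 2⁻¹ ^ N) * totalEnergy α N := by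
  have hρ : (1 / 2 : ℝ) ^ N / α ^ N = ((2 * α) ^ N)⁻¹ := by
    rw [← div_pow, ← inv_pow]; congr 1; field_simp
  have hΦ := fun s => continuous_slantFourier h0 h1 s
  rw [pairMass_eq_sum h0 h1, hρ]
  simp only [mul_zero, zero_add]
  calc _ ≤ (4 : ENNReal)⁻¹ ^ N * ∑ S ∈ (Finset.range N).powerset,
        2 * (ENNReal.ofReal ((2 * α) ^ N))⁻¹ * ∫⁻ η in Ioc (-(2 * α) ^ N) ((2 * α) ^ N),
          ‖slantFourier α (signedSum (2 * α)⁻¹ N S) η‖ₑ ^ 2 := by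
        gcongr with S
        exact pairMass_zero_le h0 h1 _ (by positivity)
    _ = _ := by
        unfold totalEnergy meanEnergy
        rw [lintegral_const_mul _ (Finset.measurable_fun_sum _ fun S _ =>
          (hΦ _).measurable.enorm.pow_const 2), lintegral_finsetSum _ fun S _ =>
          (hΦ _).measurable.enorm.pow_const 2, ← Finset.mul_sum,
          ENNReal.ofReal_pow (by positivity), ENNReal.inv_pow (a := ENNReal.ofReal (2 * α))]
        have : (4 : ENNReal)⁻¹ = 2⁻¹ * 2⁻¹ := by
          rw [← ENNReal.mul_inv (by simp) (by simp)]; norm_num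
        rw [this, mul_pow]
        ring

lemma meanEnergy_le (h0 : 1 / 2 < α) (h1 : α < 1) {k : ℕ} (hk : 0 < k)
    (hαk : (2 * α)⁻¹ ^ k ≤ 1 / 2) {j N : ℕ} (hj : j < N) {η : ℝ}
    (hη1 : |η| ≤ (2 * α) ^ (j + 1)) (hη0 : (2 * α) ^ j ≤ |η|) :
    meanEnergy α N η ≤ 2⁻¹ ^ (j / k) *
      ∫⁻ ξ in Ioc (-((1 - (2 * α)⁻¹)⁻¹ * (2 * α) ^ (j + 1)))
        ((1 - (2 * α)⁻¹)⁻¹ * (2 * α) ^ (j + 1)), ‖graphFourier α ξ η‖ₑ ^ 2 := by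
  classical
  have hα0 : 0 < α := by linarith
  have hβ0 : 0 < (2 * α)⁻¹ := by positivity
  have hβ1 : (2 * α)⁻¹ < 1 := inv_lt_one_of_one_lt₀ (by linarith)
  set β := (2 * α)⁻¹ with hβ
  set B := (1 - β)⁻¹ * (2 * α) ^ (j + 1) with hB
  set E : ℝ → ENNReal := fun ξ => ‖graphFourier α ξ η‖ₑ ^ 2
  have hE : Measurable E := (((continuous_graphFourier hα0 h1).comp
    (by fun_prop : Continuous fun ξ : ℝ => (ξ, η))).measurable.enorm.pow_const 2)
  have hLN : k * (j / k) ≤ N := (Nat.mul_div_le j k).trans hj.le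
  have hLN' : j / k ≤ N := (Nat.div_le_self j k).trans hj.le
  set I : Finset ℕ → Set ℝ := fun S =>
    Ioc (η * signedSum β N S - 1 / 2) (η * signedSum β N S + 1 / 2) with hI
  have hpt (ξ : ℝ) : ∑ S ∈ (Finset.range N).powerset, (I S).indicator E ξ ≤
      2 ^ (N - j / k) * (Ioc (-B) B).indicator E ξ := by
    simp only [indicator_apply]
    rw [← Finset.sum_filter, Finset.sum_const, nsmul_eq_mul]
    set F := (Finset.range N).powerset.filter fun S => ξ ∈ I S with hF
    rcases F.eq_empty_or_nonempty with hF0 | ⟨S, hS⟩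
    · simp [hF0]
    · have hξ : ξ ∈ Ioc (-B) B := by
        have h2 := (Finset.mem_filter.1 hS).2
        have h3 : |η * signedSum β N S| ≤ (2 * α) ^ (j + 1) * (β / (1 - β)) := by
          rw [abs_mul]
          gcongr
          exact abs_signedSum_le hβ0 hβ1 N S
        have h4 : B = (2 * α) ^ (j + 1) * (β / (1 - β)) + (2 * α) ^ (j + 1) := by
          rw [hB]
          have : 1 - β ≠ 0 := by linarith
          field_simp
          ring
        have h5 : 1 ≤ (2 * α) ^ (j + 1) := one_le_pow₀ (by linarith)
        obtain ⟨h6, h7⟩ := abs_le.1 h3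
        exact ⟨by linarith [h2.1], by linarith [h2.2]⟩
      rw [if_pos hξ]
      gcongr
      have := card_le_of_signedSum_close hβ0 hk hαk hLN F (Finset.filter_subset _ _)
        fun S hS S' hS' => by
          have h2 := (Finset.mem_filter.1 hS).2
          have h3 := (Finset.mem_filter.1 hS').2
          have h4 : |η| * |signedSum β N S - signedSum β N S'| ≤ 1 := by
            rw [← abs_mul, mul_sub, abs_le]
            exact ⟨by linarith [h2.1, h2.2, h3.1, h3.2], by linarith [h2.1, h2.2, h3.1, h3.2]⟩
          have h5 : (2 * α) ^ j * |signedSum β N S - signedSum β N S'| ≤ 1 :=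
            (mul_le_mul_of_nonneg_right hη0 (abs_nonneg _)).trans h4
          have h6 : |signedSum β N S - signedSum β N S'| ≤ β ^ j := by
            calc _ ≤ 1 / (2 * α) ^ j := (le_div_iff₀' (by positivity)).2 h5
              _ = β ^ j := by rw [hβ, inv_pow, one_div]
          have h7 : β ^ j ≤ β ^ (k * (j / k)) :=
            pow_le_pow_of_le_one hβ0.le hβ1.le (Nat.mul_div_le j k)
          have h8 : 0 < β ^ (k * (j / k)) := by positivity
          linarith
      exact_mod_cast this
  calc meanEnergy α N η
      ≤ 2⁻¹ ^ N * ∑ S ∈ (Finset.range N).powerset, ∫⁻ ξ, (I S).indicator E ξ := by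
        unfold meanEnergy
        gcongr with S
        rw [lintegral_indicator measurableSet_Ioc]
        exact enorm_slantFourier_sq_le hα0 h1 _ η
    _ ≤ 2⁻¹ ^ N * ∫⁻ ξ, 2 ^ (N - j / k) * (Ioc (-B) B).indicator E ξ := by
        rw [← lintegral_finsetSum _ fun S _ => hE.indicator measurableSet_Ioc]
        gcongr with ξ
        exact hpt ξ
    _ = 2⁻¹ ^ (j / k) * ∫⁻ ξ in Ioc (-B) B, E ξ := by
        rw [lintegral_const_mul _ (hE.indicator measurableSet_Ioc),
          lintegral_indicator measurableSet_Ioc, ← mul_assoc]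
        congr 1
        nth_rw 1 [← Nat.add_sub_of_le hLN']
        rw [pow_add, mul_assoc, ← mul_pow, ENNReal.inv_mul_cancel (by simp) (by simp), one_pow,
          mul_one]

lemma totalEnergy_le (h0 : 1 / 2 < α) (h1 : α < 1) {k : ℕ} (hk : 0 < k)
    (hαk : (2 * α)⁻¹ ^ k ≤ 1 / 2) (N : ℕ) :
    totalEnergy α N ≤ 2 + ∑ j ∈ Finset.range N, 2⁻¹ ^ (j / k) *
      squareEnergy α ((1 - (2 * α)⁻¹)⁻¹ * (2 * α) ^ (j + 1)) := by
  have hα0 : 0 < α := by linarith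
  have hβ1 : (2 * α)⁻¹ < 1 := inv_lt_one_of_one_lt₀ (by linarith)
  have hD : 1 ≤ (1 - (2 * α)⁻¹)⁻¹ := (one_le_inv₀ (by linarith)).2 (by
    have : 0 < (2 * α)⁻¹ := by positivity
    linarith)
  suffices h : ∀ J ≤ N, ∫⁻ η in Ioc (-(2 * α) ^ J) ((2 * α) ^ J), meanEnergy α N η ≤
      2 + ∑ j ∈ Finset.range J, 2⁻¹ ^ (j / k) *
        squareEnergy α ((1 - (2 * α)⁻¹)⁻¹ * (2 * α) ^ (j + 1)) from h N le_rfl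
  intro J
  induction J with
  | zero =>
    intro _
    calc ∫⁻ η in Ioc (-(2 * α) ^ 0) ((2 * α) ^ 0), meanEnergy α N η
        ≤ ∫⁻ η in Ioc (-(2 * α) ^ 0) ((2 * α) ^ 0), 1 :=
          lintegral_mono fun η => meanEnergy_le_one N η
      _ = 2 := by
          rw [setLIntegral_const, Real.volume_Ioc]; norm_num
      _ ≤ _ := by simp
  | succ J ih =>
    intro hJ
    set A := Ioc (-(2 * α) ^ J) ((2 * α) ^ J)
    set A' := Ioc (-(2 * α) ^ (J + 1)) ((2 * α) ^ (J + 1)) with hA'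
    set B := (1 - (2 * α)⁻¹)⁻¹ * (2 * α) ^ (J + 1) with hB
    have hBle : (2 * α) ^ (J + 1) ≤ B := le_mul_of_one_le_left (by positivity) hD
    have hsub : A' ⊆ A ∪ (A' \ A) := by rw [union_sdiff_self]; exact subset_union_right
    calc ∫⁻ η in A', meanEnergy α N η
        ≤ (∫⁻ η in A, meanEnergy α N η) + ∫⁻ η in A' \ A, meanEnergy α N η :=
          (lintegral_mono_set hsub).trans (lintegral_union_le _ _ _)
      _ ≤ (2 + ∑ j ∈ Finset.range J, 2⁻¹ ^ (j / k) *
          squareEnergy α ((1 - (2 * α)⁻¹)⁻¹ * (2 * α) ^ (j + 1))) +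
          2⁻¹ ^ (J / k) * squareEnergy α B := by
          refine add_le_add (ih (by omega)) ?_
          have hm : Measurable fun η => ∫⁻ ξ in Ioc (-B) B, ‖graphFourier α ξ η‖ₑ ^ 2 :=
            Measurable.lintegral_prod_left' (f := fun q : ℝ × ℝ => ‖graphFourier α q.1 q.2‖ₑ ^ 2)
              ((continuous_graphFourier hα0 h1).measurable.enorm.pow_const 2)
          calc ∫⁻ η in A' \ A, meanEnergy α N η
              ≤ ∫⁻ η in A' \ A, 2⁻¹ ^ (J / k) *
                ∫⁻ ξ in Ioc (-B) B, ‖graphFourier α ξ η‖ₑ ^ 2 := by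
                refine setLIntegral_mono (by fun_prop) fun η hη => ?_
                refine meanEnergy_le h0 h1 hk hαk hJ (abs_le.2 ⟨hη.1.1.le, hη.1.2⟩) ?_
                by_contra! h
                obtain ⟨h2, h3⟩ := abs_lt.1 h
                exact hη.2 ⟨h2, h3.le⟩
            _ ≤ ∫⁻ η in Ioc (-B) B, 2⁻¹ ^ (J / k) *
                ∫⁻ ξ in Ioc (-B) B, ‖graphFourier α ξ η‖ₑ ^ 2 :=
                lintegral_mono_set (sdiff_subset.trans (Ioc_subset_Ioc (by linarith) hBle))
            _ = _ := lintegral_const_mul _ hm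
      _ = _ := by rw [Finset.sum_range_succ, add_assoc]

end

/-! ### Solving the energy recursion -/

/-- A discrete Grönwall inequality with a delayed argument. -/
lemma exists_bound_of_le_add_sum {g r : ℕ → ENNReal} {d : ℕ → ℕ} {c : ENNReal} (hc : c ≠ ⊤)
    (hr : ∑' j, r j ≠ ⊤) (hd : ∀ j, d j ≤ j)
    (hg : ∀ N, g N ≤ c + ∑ j ∈ Finset.range N, r j * g (d j)) :
    ∃ K : ENNReal, K ≠ ⊤ ∧ ∀ N, g N ≤ K := by
  set b : ℕ → ENNReal := fun N => c * ∏ j ∈ Finset.range N, (1 + r j) with hb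
  have hbsum (N : ℕ) : c + ∑ j ∈ Finset.range N, r j * b j = b N := by
    induction N with
    | zero => simp [hb]
    | succ N ih =>
      rw [Finset.sum_range_succ, ← add_assoc, ih]
      simp only [hb, Finset.prod_range_succ]
      ring
  have hbmono : Monotone b := monotone_nat_of_le_succ fun N => by
    simp only [hb, Finset.prod_range_succ, ← mul_assoc]
    exact le_mul_of_one_le_right' le_self_add
  have hgb (N : ℕ) : g N ≤ b N := by
    induction N using Nat.strong_induction_on with
    | _ N ih =>
      refine (hg N).trans ?_
      rw [← hbsum N]
      gcongr with j hj
      exact (ih _ ((hd j).trans_lt (Finset.mem_range.1 hj))).trans (hbmono (hd j))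
  refine ⟨c * ENNReal.ofReal (Real.exp (∑' j, r j).toReal),
    ENNReal.mul_ne_top hc ENNReal.ofReal_ne_top, fun N => (hgb N).trans ?_⟩
  have hrt (j : ℕ) : r j ≠ ⊤ := ENNReal.ne_top_of_tsum_ne_top hr j
  refine mul_le_mul_right ?_ _
  calc ∏ j ∈ Finset.range N, (1 + r j)
      ≤ ∏ j ∈ Finset.range N, ENNReal.ofReal (Real.exp (r j).toReal) := by
        gcongr with j
        rw [← ENNReal.ofReal_toReal (hrt j), ← ENNReal.ofReal_one,
          ← ENNReal.ofReal_add zero_le_one ENNReal.toReal_nonneg, add_comm,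
          ENNReal.toReal_ofReal ENNReal.toReal_nonneg]
        exact ENNReal.ofReal_le_ofReal (Real.add_one_le_exp _)
    _ = ENNReal.ofReal (Real.exp (∑ j ∈ Finset.range N, r j).toReal) := by
        rw [← ENNReal.ofReal_prod_of_nonneg fun j _ => (Real.exp_pos _).le, ← Real.exp_sum,
          ENNReal.toReal_sum fun j _ => hrt j]
    _ ≤ _ := by
        gcongr
        exact ENNReal.sum_le_tsum _

section

variable {α : ℝ}

lemma squareEnergy_le (h0 : 0 < α) (h1 : α < 1) (n : ℕ) {B : ℝ} (hB : 2 ^ n ≤ 2 * B) :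
    squareEnergy α B ≤ cellConst * ENNReal.ofReal (128 * B ^ 2 * (((2 * α)⁻¹) ^ n * 2⁻¹ ^ n)) *
      totalEnergy α n := by
  have h2 : (2 : ENNReal)⁻¹ = ENNReal.ofReal 2⁻¹ := by
    rw [ENNReal.ofReal_inv_of_pos two_pos]; simp
  calc squareEnergy α B ≤ ENNReal.ofReal (64 * B ^ 2) * (cellConst *
        (2 * ((ENNReal.ofReal (2 * α))⁻¹ ^ n * 2⁻¹ ^ n) * totalEnergy α n)) :=
        (lintegral_graphFourier_le h0 h1 n hB).trans (by
          gcongr; exact pairMass_le_totalEnergy h0 h1 n)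
    _ = _ := by
        rw [← ENNReal.ofReal_inv_of_pos (by positivity), h2, ← ENNReal.ofReal_pow (by positivity),
          ← ENNReal.ofReal_pow (by positivity), ← ENNReal.ofReal_mul (by positivity),
          ← ENNReal.ofReal_ofNat 2, ← ENNReal.ofReal_mul zero_le_two,
          show 128 * B ^ 2 * (((2 * α)⁻¹) ^ n * 2⁻¹ ^ n) =
            64 * B ^ 2 * (2 * (((2 * α)⁻¹) ^ n * 2⁻¹ ^ n)) by ring,
          ENNReal.ofReal_mul (p := 64 * B ^ 2) (by positivity)]
        ring

lemma exists_totalEnergy_le (h0 : 1 / 2 < α) (h1 : α < 1) :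
    ∃ K : ENNReal, K ≠ ⊤ ∧ ∀ N, totalEnergy α N ≤ K := by
  have hα0 : 0 < α := by linarith
  set κ := Real.logb 2 (2 * α) with hκ
  have hx : (2 : ℝ) ^ κ = 2 * α := Real.rpow_logb two_pos (by norm_num) (by positivity)
  have hκ0 : 0 < κ := Real.logb_pos one_lt_two (by linarith)
  have hκ1 : κ < 1 := by
    rw [hκ, Real.logb_lt_iff_lt_rpow one_lt_two (by positivity), Real.rpow_one]; linarith
  set k := ⌈1 / κ⌉₊ with hk
  have hk0 : 0 < k := Nat.ceil_pos.2 (by positivity)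
  have hk0' : (0 : ℝ) < k := Nat.cast_pos.2 hk0
  have hk1 : 1 ≤ k * κ := (div_le_iff₀ hκ0).1 (Nat.le_ceil _)
  have hk2 : k * κ < 1 + κ := by
    have := Nat.ceil_lt_add_one (a := 1 / κ) (by positivity)
    calc k * κ < (1 / κ + 1) * κ := by gcongr
      _ = 1 + κ := by field_simp
  have hαk : (2 * α)⁻¹ ^ k ≤ 1 / 2 := by
    rw [← hx, ← Real.rpow_neg zero_le_two, ← Real.rpow_mul_natCast zero_le_two, one_div,
      ← Real.rpow_neg_one]
    exact Real.rpow_le_rpow_of_exponent_le one_le_two (by linarith)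
  set D := (1 - (2 * α)⁻¹)⁻¹ with hD
  have hD1 : 1 ≤ D := (one_le_inv₀ (by
    linarith [inv_lt_one_of_one_lt₀ (by linarith : 1 < 2 * α)])).2 (by
    have : 0 < (2 * α)⁻¹ := by positivity
    linarith)
  set n : ℕ → ℕ := fun j => ⌊κ * j⌋₊ with hn
  have hn1 (j : ℕ) : (n j : ℝ) ≤ κ * j := Nat.floor_le (by positivity)
  have hn2 (j : ℕ) : κ * j < n j + 1 := Nat.lt_floor_add_one _
  set e := κ - κ ^ 2 - 1 / k with he
  have he0 : e < 0 := by
    have : (κ - κ ^ 2) * k < 1 := by nlinarith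
    have := (lt_div_iff₀ hk0').2 this
    linarith
  set r : ℕ → ℝ := fun j => 2⁻¹ ^ (j / k) *
    (128 * (D * (2 * α) ^ (j + 1)) ^ 2 * ((2 * α)⁻¹ ^ n j * 2⁻¹ ^ n j)) with hr
  have hr0 (j : ℕ) : 0 ≤ r j := by positivity
  have hrle (j : ℕ) : r j ≤ 128 * D ^ 2 * 2 ^ (2 + 3 * κ) * (2 ^ e) ^ j := by
    have hm : (j : ℝ) / k < (j / k : ℕ) + 1 := by
      rw [div_lt_iff₀ hk0']
      rw [add_one_mul]
      exact_mod_cast Nat.lt_div_mul_add hk0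
    have e1 : r j = 128 * D ^ 2 * 2 ^ (-((j / k : ℕ) : ℝ) + κ * (j + 1 : ℕ) * (2 : ℕ) +
        (-κ * (n j) + -(n j))) := by
      simp only [hr, Real.rpow_add two_pos, neg_mul, Real.rpow_neg zero_le_two,
        Real.rpow_mul zero_le_two, Real.rpow_natCast, hx, inv_pow]
      ring
    rw [e1, mul_assoc (128 * D ^ 2), ← Real.rpow_mul_natCast zero_le_two, ← Real.rpow_add two_pos]
    refine mul_le_mul_of_nonneg_left (Real.rpow_le_rpow_of_exponent_le one_le_two ?_)
      (by positivity)
    push_cast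
    have e2 : e * j = κ * j - κ * (κ * j) - j / k := by rw [he]; ring
    rw [e2]
    nlinarith [hn2 j]
  have hsum : ∑' j, cellConst * ENNReal.ofReal (r j) ≠ ⊤ := by
    rw [ENNReal.tsum_mul_left]
    refine ENNReal.mul_ne_top cellConst_ne_top ?_
    have hs : Summable r := Summable.of_nonneg_of_le hr0 hrle
      ((summable_geometric_of_lt_one (by positivity)
        (Real.rpow_lt_one_of_one_lt_of_neg one_lt_two he0)).mul_left _)
    rw [← ENNReal.ofReal_tsum_of_nonneg hr0 hs]
    exact ENNReal.ofReal_ne_top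
  refine exists_bound_of_le_add_sum (c := 2) (by simp) hsum (d := n) (fun j => ?_) fun N => ?_
  · have : (n j : ℝ) ≤ j := (hn1 j).trans (mul_le_of_le_one_left (by positivity) hκ1.le)
    exact_mod_cast this
  · refine (totalEnergy_le h0 h1 hk0 hαk N).trans ?_
    refine add_le_add_right (Finset.sum_le_sum fun j _ => ?_) _
    have hB : 2 ^ n j ≤ 2 * (D * (2 * α) ^ (j + 1)) := by
      calc (2 : ℝ) ^ n j ≤ 2 ^ (κ * (j + 1 : ℕ)) := by
            rw [← Real.rpow_natCast]
            refine Real.rpow_le_rpow_of_exponent_le one_le_two ?_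
            push_cast
            nlinarith [hn1 j]
        _ = (2 * α) ^ (j + 1) := by rw [Real.rpow_mul_natCast zero_le_two, hx]
        _ ≤ D * (2 * α) ^ (j + 1) := le_mul_of_one_le_left (by positivity) hD1
        _ ≤ _ := by linarith [show 0 ≤ D * (2 * α) ^ (j + 1) by positivity]
    have h2 : (2 : ENNReal)⁻¹ = ENNReal.ofReal 2⁻¹ := by
      rw [ENNReal.ofReal_inv_of_pos two_pos]; simp
    calc _ ≤ 2⁻¹ ^ (j / k) * (cellConst * ENNReal.ofReal _ * totalEnergy α (n j)) := by
          gcongr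
          exact squareEnergy_le hα0 h1 (n j) hB
      _ = _ := by
          simp only [hr]
          rw [ENNReal.ofReal_mul (p := 2⁻¹ ^ (j / k)) (by positivity),
            ENNReal.ofReal_pow (by positivity), ← h2]
          ring

/-- The correlation estimate for the graph at scale `2⁻ᴺ`. -/
lemma exists_pairMass_le (h0 : 1 / 2 < α) (h1 : α < 1) :
    ∃ K : ENNReal, K ≠ ⊤ ∧ ∀ N : ℕ,
      pairMass α N 0 ((1 / 2) ^ N) ≤ K * ENNReal.ofReal ((4 * α)⁻¹ ^ N) := by
  have hα0 : 0 < α := by linarith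
  obtain ⟨K, hK, hle⟩ := exists_totalEnergy_le h0 h1
  have h2 : (2 : ENNReal)⁻¹ = ENNReal.ofReal 2⁻¹ := by
    rw [ENNReal.ofReal_inv_of_pos two_pos]; simp
  refine ⟨2 * K, ENNReal.mul_ne_top (by simp) hK, fun N => ?_⟩
  calc _ ≤ 2 * ((ENNReal.ofReal (2 * α))⁻¹ ^ N * 2⁻¹ ^ N) * K :=
        (pairMass_le_totalEnergy hα0 h1 N).trans (by gcongr; exact hle N)
    _ = _ := by
        rw [← mul_pow, ← ENNReal.ofReal_inv_of_pos (by positivity), h2,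
          ← ENNReal.ofReal_mul (by positivity), ← ENNReal.ofReal_pow (by positivity),
          ← mul_inv, show 2 * α * 2 = 4 * α by ring]
        ring

end

/-! ### The lower bound for the dimension -/

/-- The measure of the parameters whose graph points are at sup-distance at most `2⁻ᴺ` from that
of `x`. -/
noncomputable def graphMass (α : ℝ) (N : ℕ) (x : ℝ) : ENNReal :=
  unitVol {y | |x - y| ≤ (1 / 2) ^ N ∧ |takagi α x - takagi α y| ≤ (1 / 2) ^ N}

section

variable {α : ℝ}

lemma measurableSet_graph_close (h0 : 0 < α) (h1 : α < 1) (r : ℝ) :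
    MeasurableSet {z : ℝ × ℝ | |z.1 - z.2| ≤ r ∧ |takagi α z.1 - takagi α z.2| ≤ r} := by
  have hT := continuous_takagi h0 h1
  have h2 : IsClosed {z : ℝ × ℝ | |z.1 - z.2| ≤ r} := isClosed_le (by fun_prop) continuous_const
  have h3 : IsClosed {z : ℝ × ℝ | |takagi α z.1 - takagi α z.2| ≤ r} :=
    isClosed_le (by fun_prop) continuous_const
  exact (h2.inter h3).measurableSet

lemma measurable_graphMass (h0 : 0 < α) (h1 : α < 1) (N : ℕ) : Measurable (graphMass α N) :=
  measurable_measure_prodMk_left (measurableSet_graph_close h0 h1 _)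

lemma lintegral_graphMass_le (h0 : 0 < α) (h1 : α < 1) (N : ℕ) :
    ∫⁻ x, graphMass α N x ∂unitVol ≤ 4 * (cellConst * pairMass α N 0 ((1 / 2) ^ N)) := by
  have hs := measurableSet_graph_close h0 h1 ((1 / 2) ^ N)
  have hclose {x : ℝ} (hx : |x| ≤ (1 / 2) ^ N) : 1 / 2 ≤ fejer (2 ^ N * x) := by
    refine half_le_fejer ?_
    rw [abs_mul, abs_of_pos (by positivity)]
    calc (2 : ℝ) ^ N * |x| ≤ 2 ^ N * (1 / 2) ^ N := by gcongr
      _ = 1 := by rw [← mul_pow]; norm_num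
  calc ∫⁻ x, graphMass α N x ∂unitVol
      = ∫⁻ z, {z : ℝ × ℝ | |z.1 - z.2| ≤ (1 / 2) ^ N ∧
          |takagi α z.1 - takagi α z.2| ≤ (1 / 2) ^ N}.indicator 1 z ∂unitVol.prod unitVol := by
        rw [lintegral_indicator_one hs, Measure.prod_apply hs]
        rfl
    _ ≤ ∫⁻ z, 4 * ENNReal.ofReal (fejer (2 ^ N * (z.1 - z.2)) *
          fejer (2 ^ N * (takagi α z.1 - takagi α z.2))) ∂unitVol.prod unitVol := by
        refine lintegral_mono fun z => ?_
        rw [indicator_apply]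
        split_ifs with hz
        swap
        · exact zero_le
        rw [Pi.one_apply, ← ENNReal.ofReal_ofNat 4, ← ENNReal.ofReal_mul (by norm_num)]
        refine ENNReal.one_le_ofReal.2 ?_
        nlinarith [hclose hz.1, hclose hz.2]
    _ ≤ _ := by
        rw [lintegral_const_mul' _ _ (by simp)]
        gcongr
        exact lintegral_fejer_mul_fejer_le h0 h1 N le_rfl

lemma hausdorffMeasure_graph_ne_zero (h0 : 1 / 2 < α) (h1 : α < 1) {d : ℝ} (hd0 : 0 < d)
    (hd : 2 ^ d < 4 * α) :
    μH[d] {p : ℝ × ℝ | ∃ x ∈ Set.Icc (0:ℝ) 1, p = (x, takagi α x)} ≠ 0 := by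
  have hα0 : 0 < α := by linarith
  have hT := continuous_takagi hα0 h1
  have hM := measurable_graphMass hα0 h1
  have h2d : (0 : ℝ) < 2 ^ d := by positivity
  obtain ⟨K, hK, hle⟩ := exists_pairMass_le h0 h1
  set Ψ : ℝ → ENNReal := fun x => ∑' N : ℕ, ENNReal.ofReal ((2 ^ d) ^ N) * graphMass α N x with hΨ
  have hΨm : Measurable Ψ := Measurable.tsum fun N => (hM N).const_mul _
  have hΨint : ∫⁻ x, Ψ x ∂unitVol ≠ ⊤ := by
    rw [hΨ, lintegral_tsum fun N => ((hM N).const_mul _).aemeasurable]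
    have hbound (N : ℕ) : ∫⁻ x, ENNReal.ofReal ((2 ^ d) ^ N) * graphMass α N x ∂unitVol ≤
        4 * cellConst * K * ENNReal.ofReal ((2 ^ d * (4 * α)⁻¹) ^ N) := by
      rw [lintegral_const_mul _ (hM N), mul_pow, ENNReal.ofReal_mul (by positivity)]
      calc _ ≤ ENNReal.ofReal ((2 ^ d) ^ N) * (4 * (cellConst *
            (K * ENNReal.ofReal ((4 * α)⁻¹ ^ N)))) := by
            gcongr
            exact (lintegral_graphMass_le hα0 h1 N).trans (by gcongr; exact hle N)
        _ = _ := by ring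
    refine ne_top_of_le_ne_top ?_ (ENNReal.tsum_le_tsum hbound)
    rw [ENNReal.tsum_mul_left, ← ENNReal.ofReal_tsum_of_nonneg (fun N => by positivity)]
    · exact ENNReal.mul_ne_top (ENNReal.mul_ne_top (ENNReal.mul_ne_top (by simp)
        cellConst_ne_top) hK) ENNReal.ofReal_ne_top
    · refine summable_geometric_of_lt_one (by positivity) ?_
      rw [← div_eq_mul_inv, div_lt_one (by positivity)]
      exact hd
  obtain ⟨R, hR⟩ : ∃ R : ℕ, unitVol {x | Ψ x ≤ R} ≠ 0 := by
    by_contra! h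
    have h2 := measure_iUnion_null h
    have h3 := ae_lt_top hΨm hΨint
    have h4 : ∀ᵐ x ∂unitVol, x ∉ ⋃ R : ℕ, {x | Ψ x ≤ R} := measure_eq_zero_iff_ae_notMem.1 h2
    obtain ⟨x, hx, hx'⟩ := (h3.and h4).exists
    obtain ⟨R, hR⟩ := ENNReal.exists_nat_gt hx.ne
    exact hx' (mem_iUnion.2 ⟨R, hR.le⟩)
  set G := {x | Ψ x ≤ R} with hG
  have hGm : MeasurableSet G := measurableSet_le hΨm measurable_const
  set φ : ℝ → ℝ × ℝ := fun x => (x, takagi α x) with hφ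
  have hφm : Measurable φ := by fun_prop
  set μ := (unitVol.restrict G).map φ with hμ
  set c : ENNReal := R * ENNReal.ofReal (2 ^ d) + 1 with hc
  have hc0 : c ≠ 0 := by simp [hc]
  have hct : c ≠ ⊤ :=
    ENNReal.add_ne_top.2 ⟨ENNReal.mul_ne_top (by simp) ENNReal.ofReal_ne_top, by simp⟩
  have hμle (U : Set (ℝ × ℝ)) (hU : Metric.ediam U ≤ 1) : μ U ≤ c * Metric.ediam U ^ d := by
    have hUm : MeasurableSet (closure U) := isClosed_closure.measurableSet
    have h2 : μ U ≤ unitVol (φ ⁻¹' closure U ∩ G) := by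
      refine (measure_mono subset_closure).trans ?_
      rw [hμ, Measure.map_apply hφm hUm, Measure.restrict_apply (hφm hUm)]
    rcases (φ ⁻¹' closure U ∩ G).eq_empty_or_nonempty with he | ⟨x, hxU, hxG⟩
    · simp [le_antisymm (h2.trans_eq (by rw [he, measure_empty])) zero_le]
    have hdist {y : ℝ} (hy : φ y ∈ closure U) : edist (φ x) (φ y) ≤ Metric.ediam U := by
      rw [← Metric.ediam_closure]
      exact Metric.edist_le_ediam_of_mem hxU hy
    rcases eq_or_ne (Metric.ediam U) 0 with hz | hz
    · have h3 : φ ⁻¹' closure U ∩ G ⊆ {x} := fun y hy => by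
        have := hdist hy.1
        rw [hz, nonpos_iff_eq_zero, edist_eq_zero] at this
        exact (congrArg Prod.fst this).symm
      have h4 : unitVol {x} = 0 := by simp
      exact (h2.trans ((measure_mono h3).trans_eq h4)).trans zero_le
    · have hfin : Metric.ediam U ≠ ⊤ := ne_top_of_le_ne_top (by simp) hU
      set t := (Metric.ediam U).toReal with ht
      have htU : Metric.ediam U = ENNReal.ofReal t := (ENNReal.ofReal_toReal hfin).symm
      have ht0 : 0 < t := ENNReal.toReal_pos hz hfin
      have ht1 : t ≤ 1 := by
        rw [htU] at hU
        simpa using hU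
      obtain ⟨N, hN1, hN2⟩ := exists_nat_pow_near_of_lt_one ht0 ht1
        (by norm_num : (0 : ℝ) < 1 / 2) (by norm_num)
      have h3 : φ ⁻¹' closure U ⊆
          {y | |x - y| ≤ (1 / 2) ^ N ∧ |takagi α x - takagi α y| ≤ (1 / 2) ^ N} := fun y hy => by
        have h4 := hdist hy
        rw [htU, edist_dist, ENNReal.ofReal_le_ofReal_iff ht0.le, Prod.dist_eq, max_le_iff,
          Real.dist_eq, Real.dist_eq] at h4
        exact ⟨h4.1.trans hN2, h4.2.trans hN2⟩
      have h4 : ENNReal.ofReal ((2 ^ d) ^ N) * graphMass α N x ≤ R :=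
        (ENNReal.le_tsum N).trans hxG
      have h5 : ENNReal.ofReal (2 ^ d) * Metric.ediam U ^ d * ENNReal.ofReal ((2 ^ d) ^ N) ≥ 1 := by
        rw [htU, ENNReal.ofReal_rpow_of_pos ht0, ← ENNReal.ofReal_mul (by positivity),
          ← ENNReal.ofReal_mul (by positivity)]
        refine ENNReal.one_le_ofReal.2 ?_
        have h6 : ((1 / 2 : ℝ) ^ (N + 1)) ^ d ≤ t ^ d :=
          Real.rpow_le_rpow (by positivity) hN1.le hd0.le
        calc (1 : ℝ) = 2 ^ d * ((1 / 2 : ℝ) ^ (N + 1)) ^ d * (2 ^ d) ^ N := by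
              rw [one_div, inv_pow, Real.inv_rpow (by positivity), ← Real.rpow_natCast_mul
                zero_le_two, mul_comm ((N + 1 : ℕ) : ℝ), Real.rpow_mul_natCast zero_le_two, pow_succ]
              field_simp
          _ ≤ _ := by gcongr
      calc μ U ≤ graphMass α N x := h2.trans (measure_mono (inter_subset_left.trans h3))
        _ ≤ ENNReal.ofReal (2 ^ d) * Metric.ediam U ^ d * ENNReal.ofReal ((2 ^ d) ^ N) *
            graphMass α N x := le_mul_of_one_le_left' h5
        _ = ENNReal.ofReal (2 ^ d) * Metric.ediam U ^ d *
            (ENNReal.ofReal ((2 ^ d) ^ N) * graphMass α N x) := by rw [mul_assoc]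
        _ ≤ ENNReal.ofReal (2 ^ d) * Metric.ediam U ^ d * R := by gcongr
        _ = R * ENNReal.ofReal (2 ^ d) * Metric.ediam U ^ d := by ring
        _ ≤ c * Metric.ediam U ^ d := by gcongr; exact le_self_add
  have hμH : c⁻¹ • μ ≤ μH[d] := by
    refine Measure.le_hausdorffMeasure d _ 1 zero_lt_one fun U hU => ?_
    rw [Measure.smul_apply, smul_eq_mul]
    calc c⁻¹ * μ U ≤ c⁻¹ * (c * Metric.ediam U ^ d) := by gcongr; exact hμle U hU
      _ = _ := by rw [← mul_assoc, ENNReal.inv_mul_cancel hc0 hct, one_mul]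
  have hpos : 0 < μ {p : ℝ × ℝ | ∃ x ∈ Set.Icc (0:ℝ) 1, p = (x, takagi α x)} := by
    refine lt_of_lt_of_le ?_ (Measure.le_map_apply hφm.aemeasurable _)
    refine lt_of_lt_of_le (pos_iff_ne_zero.2 hR) ?_
    rw [Measure.restrict_apply' hGm]
    refine measure_mono_ae ?_
    filter_upwards [ae_unitVol_mem] with x hx hxG
    exact ⟨⟨x, ⟨hx.1, hx.2.le⟩, rfl⟩, hxG⟩
  refine (lt_of_lt_of_le ?_ (hμH _)).ne'
  rw [Measure.smul_apply, smul_eq_mul]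
  exact ENNReal.mul_pos (ENNReal.inv_ne_zero.2 hct) hpos.ne'

end

/-! ### The upper bound for the dimension -/

/-- The dyadic box of side `2⁻ᴺ` with lower left corner `(i / 2 ^ N, b + j / 2 ^ N)`. -/
def dyadicBox (N i j : ℕ) (b : ℝ) : Set (ℝ × ℝ) :=
  Icc (i * (1 / 2 : ℝ) ^ N) ((i + 1) * (1 / 2 : ℝ) ^ N) ×ˢ
    Icc (b + j * (1 / 2) ^ N) (b + (j + 1) * (1 / 2) ^ N)

lemma ediam_dyadicBox_le (N i j : ℕ) (b : ℝ) :
    Metric.ediam (dyadicBox N i j b) ≤ ENNReal.ofReal ((1 / 2) ^ N) := by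
  refine Metric.ediam_le fun x hx y hy => ?_
  obtain ⟨⟨hx1, hx2⟩, hx3, hx4⟩ := hx
  obtain ⟨⟨hy1, hy2⟩, hy3, hy4⟩ := hy
  rw [edist_dist]
  refine ENNReal.ofReal_le_ofReal ?_
  rw [Prod.dist_eq, Real.dist_eq, Real.dist_eq]
  refine max_le (abs_le.2 ⟨?_, ?_⟩) (abs_le.2 ⟨?_, ?_⟩) <;> linarith

lemma mem_floor_cell {t : ℝ} (ht : 0 ≤ t) (N : ℕ) :
    t ∈ Icc (⌊2 ^ N * t⌋₊ * (1 / 2 : ℝ) ^ N) ((⌊2 ^ N * t⌋₊ + 1) * (1 / 2 : ℝ) ^ N) := by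
  have h1 := Nat.floor_le (show 0 ≤ 2 ^ N * t by positivity)
  have h2 := (Nat.lt_floor_add_one (2 ^ N * t)).le
  have h3 : (1 / 2 : ℝ) ^ N * 2 ^ N = 1 := by rw [← mul_pow]; norm_num
  have h4 : t = 2 ^ N * t * (1 / 2 : ℝ) ^ N := by linear_combination (-t) * h3
  constructor
  · conv_rhs => rw [h4]
    gcongr
  · conv_lhs => rw [h4]
    gcongr

section

variable {α : ℝ}

lemma hausdorffMeasure_graph_ne_top (h0 : 1 / 2 < α) (h1 : α < 1) {d : ℝ} (hd0 : 0 ≤ d)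
    (hd : 2 ^ d = 4 * α) :
    μH[d] {p : ℝ × ℝ | ∃ x ∈ Set.Icc (0:ℝ) 1, p = (x, takagi α x)} ≠ ⊤ := by
  have hα0 : 0 < α := by linarith
  set C : ℝ := 1 / (2 * α - 1) + 1 / (1 - α) with hC
  have hC0 : 0 ≤ C := by
    have h2 : 0 < 2 * α - 1 := by linarith
    have h3 : 0 < 1 - α := by linarith
    positivity
  set M : ℕ → ℕ := fun N => ⌊2 ^ N * (2 * (C * α ^ N))⌋₊ + 1 with hM
  set b : ℕ → ℕ → ℝ := fun N i => takagi α (i * (1 / 2) ^ N) - C * α ^ N with hb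
  have hle := Measure.hausdorffMeasure_le_liminf_sum (l := Filter.atTop)
    (ι := fun N : ℕ => Fin (2 ^ N + 1) × Fin (M N)) d
    {p : ℝ × ℝ | ∃ x ∈ Set.Icc (0:ℝ) 1, p = (x, takagi α x)}
    (fun N => ENNReal.ofReal ((1 / 2) ^ N)) ?_
    (fun N ij => dyadicBox N ij.1 ij.2 (b N ij.1))
    (Filter.Eventually.of_forall fun N ij => ediam_dyadicBox_le N _ _ _)
    (Filter.Eventually.of_forall fun N => ?_)
  · refine ne_top_of_le_ne_top (ENNReal.ofReal_ne_top (r := 2 * (2 * C + 1))) (hle.trans ?_)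
    refine Filter.liminf_le_of_frequently_le' (Filter.Frequently.of_forall fun N => ?_)
    have hbox (ij : Fin (2 ^ N + 1) × Fin (M N)) :
        Metric.ediam (dyadicBox N ij.1 ij.2 (b N ij.1)) ^ d ≤
          ENNReal.ofReal ((4 * α)⁻¹ ^ N) := by
      calc _ ≤ ENNReal.ofReal ((1 / 2) ^ N) ^ d := by
            gcongr
            exact ediam_dyadicBox_le N _ _ _
        _ = _ := by
            rw [ENNReal.ofReal_rpow_of_pos (by positivity), ← hd, one_div, inv_pow,
              Real.inv_rpow (by positivity), ← Real.rpow_natCast_mul zero_le_two, mul_comm,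
              Real.rpow_mul_natCast zero_le_two, inv_pow]
    refine (Finset.sum_le_sum fun ij _ => hbox ij).trans ?_
    rw [Finset.sum_const, nsmul_eq_mul, ← ENNReal.ofReal_natCast,
      ← ENNReal.ofReal_mul (by positivity)]
    refine ENNReal.ofReal_le_ofReal ?_
    have hcard : ((Finset.univ : Finset (Fin (2 ^ N + 1) × Fin (M N))).card : ℝ) =
        (2 ^ N + 1) * (⌊2 ^ N * (2 * (C * α ^ N))⌋₊ + 1) := by
      simp [hM]
    have hone : (1 : ℝ) ≤ 2 ^ N := one_le_pow₀ (by norm_num)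
    have hone' : (1 : ℝ) ≤ 2 ^ N * α ^ N := by
      rw [← mul_pow]
      exact one_le_pow₀ (by linarith)
    have hfl := Nat.floor_le (show 0 ≤ 2 ^ N * (2 * (C * α ^ N)) by positivity)
    have hinv : (4 * α) ^ N * (4 * α)⁻¹ ^ N = 1 := by
      rw [← mul_pow, mul_inv_cancel₀ (by positivity), one_pow]
    have hfour : (4 * α) ^ N = 2 ^ N * (2 ^ N * α ^ N) := by
      rw [← mul_pow, ← mul_pow]; ring
    rw [hcard]
    calc _ ≤ (2 * 2 ^ N) * ((2 * C + 1) * (2 ^ N * α ^ N)) * (4 * α)⁻¹ ^ N := by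
          gcongr
          · linarith
          · linarith
      _ = 2 * (2 * C + 1) * ((4 * α) ^ N * (4 * α)⁻¹ ^ N) := by rw [hfour]; ring
      _ = _ := by rw [hinv, mul_one]
  · rw [← ENNReal.ofReal_zero]
    exact ENNReal.tendsto_ofReal (tendsto_pow_atTop_nhds_zero_of_lt_one (by norm_num) (by norm_num))
  · rintro _ ⟨x, ⟨hx0, hx1⟩, rfl⟩
    have hcell := mem_floor_cell hx0 N
    set i := ⌊2 ^ N * x⌋₊ with hi
    have hosc : |takagi α x - takagi α (i * (1 / 2) ^ N)| ≤ C * α ^ N := by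
      refine abs_takagi_sub_le h0 h1 N ?_
      rw [abs_le]
      have := pow_pos (show (0 : ℝ) < 1 / 2 by norm_num) N
      constructor <;> linarith [hcell.1, hcell.2]
    rw [abs_le] at hosc
    have hheight : 0 ≤ takagi α x - b N i := by simp only [hb]; linarith
    have hcell' := mem_floor_cell hheight N
    set j := ⌊2 ^ N * (takagi α x - b N i)⌋₊ with hj
    have hi_lt : i < 2 ^ N + 1 := by
      refine Nat.lt_succ_of_le (Nat.floor_le_of_le ?_)
      push_cast
      exact mul_le_of_le_one_right (by positivity) hx1
    have hj_lt : j < M N := by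
      refine Nat.lt_succ_of_le (Nat.floor_le_floor ?_)
      gcongr
      simp only [hb]; linarith
    refine mem_iUnion.2 ⟨(⟨i, hi_lt⟩, ⟨j, hj_lt⟩), hcell, ?_, ?_⟩
    · linarith [hcell'.1]
    · linarith [hcell'.2]

end

/-- For every `α ∈ (1/2,1)`, the Hausdorff dimension of the graph of the `α`-Takagi
function over `[0,1]` equals `2 + log α / log 2`. -/
theorem takagi_graph_dimH (α : ℝ) (hα₁ : 1 / 2 < α) (hα₂ : α < 1) :
    dimH {p : ℝ × ℝ | ∃ x ∈ Set.Icc (0:ℝ) 1, p = (x, takagi α x)} =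
      ENNReal.ofReal (2 + Real.log α / Real.log 2) := by
  have hα0 : 0 < α := by linarith
  set a : ℝ := 2 + Real.log α / Real.log 2 with ha
  have h2a : (2 : ℝ) ^ a = 4 * α := by
    rw [ha, ← Real.logb, Real.rpow_add zero_lt_two, Real.rpow_logb zero_lt_two (by norm_num) hα0]
    norm_num
  have ha0 : 0 ≤ a := by
    by_contra! h
    have := Real.rpow_lt_one_of_one_lt_of_neg one_lt_two h
    linarith
  refine le_antisymm ?_ (le_of_forall_lt fun c hc => ?_)
  · refine dimH_le_of_hausdorffMeasure_ne_top (d := a.toNNReal) ?_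
    rw [Real.coe_toNNReal a ha0]
    exact hausdorffMeasure_graph_ne_top hα₁ hα₂ ha0 h2a
  · obtain ⟨d, hcd, hda⟩ := ENNReal.lt_iff_exists_nnreal_btwn.1 hc
    refine hcd.trans_le (le_dimH_of_hausdorffMeasure_ne_zero ?_)
    refine hausdorffMeasure_graph_ne_zero hα₁ hα₂ (d := d) ?_ ?_
    · exact_mod_cast zero_le.trans_lt hcd
    · rw [← h2a]
      refine Real.rpow_lt_rpow_of_exponent_lt one_lt_two ?_
      rwa [ENNReal.ofReal, ENNReal.coe_lt_coe, Real.lt_toNNReal_iff_coe_lt] at hda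
end
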